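/- arXiv:0912.1925 — 8 statements merged into one kernel-verified Lean document; each statement's English description precedes it below -/
import Mathlib

section
/- If F₁ and F₂ are absolutely continuous and the joint d.f. of (ξ¹, ξ²) is F₁₂(x, y) = C(F₁(x), F₂(y)) for a twice continuously differentiable copula C, then P(ξ¹ = 0) = P(ξ² = 0) = 0, and for every z > 0 the joint-positive-jump sub-distribution function satisfies F_{P³}(z) := P(ξ¹ > 0, ξ² > 0, ξ¹ + ξ² ≤ z) = ∫₀^z [ ∂C/∂u (F₁(x₁), F₂(z − x₁)) − ∂C/∂u (F₁(x₁), F₂(0)) ] F₁(dx₁). -/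
open MeasureTheory Set Filter

lemma q2_cont (m : Measure ℝ) [IsProbabilityMeasure m] (h : m ≪ volume) :
    Continuous (ProbabilityTheory.cdf m) := by
  rw [continuous_iff_continuousAt]
  intro x
  rw [(ProbabilityTheory.cdf m).mono.continuousAt_iff_leftLim_eq_rightLim,
    StieltjesFunction.rightLim_eq]
  have h1 : (ProbabilityTheory.cdf m).measure {x} = 0 := by
    rw [ProbabilityTheory.measure_cdf]; exact h (by simp)
  rw [StieltjesFunction.measure_singleton, ENNReal.ofReal_eq_zero] at h1
  have h2 := (ProbabilityTheory.cdf m).mono.leftLim_le (le_refl x)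
  linarith

lemma q2_le (m : Measure ℝ) [IsProbabilityMeasure m] (h : m ≪ volume) (t : ℝ) (h0 : 0 ≤ t)
    (h1 : t ≤ 1) : m.real {x | ProbabilityTheory.cdf m x ≤ t} = t := by
  set F := ProbabilityTheory.cdf m with hF
  have hc : Continuous F := q2_cont m h
  rcases h1.eq_or_lt with rfl | h1
  · have : {x | F x ≤ 1} = univ := by
      ext x; simp [hF, ProbabilityTheory.cdf_le_one]
    rw [this]; simp
  obtain ⟨b, hb⟩ := ((ProbabilityTheory.tendsto_cdf_atTop m).eventually (lt_mem_nhds h1)).exists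
  have hbdd : BddAbove {x | F x ≤ t} :=
    ⟨b, fun x hx => by
      by_contra hlt
      have := F.mono (not_le.1 hlt).le
      have hx' : F x ≤ t := hx
      have hb' : t < F b := hb
      linarith⟩
  have hclosed : IsClosed {x | F x ≤ t} := isClosed_le hc continuous_const
  rcases eq_empty_or_nonempty {x | F x ≤ t} with he | hne
  · rw [he]
    rcases h0.eq_or_lt with rfl | h0
    · simp
    obtain ⟨c, hcc⟩ := ((ProbabilityTheory.tendsto_cdf_atBot m).eventually (gt_mem_nhds h0)).exists
    have : c ∈ {x | F x ≤ t} := le_of_lt hcc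
    rw [he] at this
    exact absurd this (by simp)
  · set a := sSup {x | F x ≤ t} with ha
    have hmem : F a ≤ t := hclosed.csSup_mem hne hbdd
    have hset : {x | F x ≤ t} = Iic a := by
      ext x
      exact ⟨fun hx => le_csSup hbdd hx, fun hx => (F.mono hx).trans hmem⟩
    have hge : t ≤ F a := by
      have htend : Tendsto F (nhdsWithin a (Ioi a)) (nhds (F a)) :=
        (hc.tendsto a).mono_left nhdsWithin_le_nhds
      refine ge_of_tendsto htend ?_
      filter_upwards [self_mem_nhdsWithin] with x hx
      by_contra hlt
      have : x ∈ Iic a := hset ▸ (not_le.1 hlt).le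
      exact absurd (mem_Ioi.1 hx) (not_lt.2 (mem_Iic.1 this))
    rw [hset, ← ProbabilityTheory.cdf_eq_real]
    exact le_antisymm hmem hge

lemma q2_map (m : Measure ℝ) [IsProbabilityMeasure m] (h : m ≪ volume) :
    m.map (ProbabilityTheory.cdf m) = volume.restrict (Icc (0:ℝ) 1) := by
  have hm : Measurable (ProbabilityTheory.cdf m) := (q2_cont m h).measurable
  have : IsProbabilityMeasure (m.map (ProbabilityTheory.cdf m)) :=
    Measure.isProbabilityMeasure_map hm.aemeasurable
  refine Measure.ext_of_Iic _ _ fun t => ?_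
  rw [Measure.map_apply hm measurableSet_Iic, Measure.restrict_apply measurableSet_Iic]
  have hpre : ProbabilityTheory.cdf m ⁻¹' Iic t = {x | ProbabilityTheory.cdf m x ≤ t} := rfl
  rw [hpre]
  rcases lt_or_ge t 0 with ht | ht
  · have e1 : {x | ProbabilityTheory.cdf m x ≤ t} = ∅ := by
      ext x
      have := ProbabilityTheory.cdf_nonneg m x
      simp only [mem_ofPred_eq, mem_empty_iff_false, iff_false, not_le]; linarith
    have e2 : Iic t ∩ Icc (0:ℝ) 1 = ∅ := by
      ext x
      simp only [mem_inter_iff, mem_Iic, mem_Icc, mem_empty_iff_false, iff_false]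
      rintro ⟨h1, h2, -⟩; linarith
    rw [e1, e2]; simp
  rcases le_or_gt t 1 with h1 | h1
  · have e2 : Iic t ∩ Icc (0:ℝ) 1 = Icc 0 t := by
      ext x
      simp only [mem_inter_iff, mem_Iic, mem_Icc]
      constructor
      · rintro ⟨a, b, c⟩; exact ⟨b, a⟩
      · rintro ⟨a, b⟩; exact ⟨b, a, b.trans h1⟩
    rw [e2, Real.volume_Icc, sub_zero, ← q2_le m h t ht h1, ofReal_measureReal, q2_le m h t ht h1]
  · have e1 : {x | ProbabilityTheory.cdf m x ≤ t} = univ := by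
      ext x
      have := ProbabilityTheory.cdf_le_one m x
      simp only [mem_ofPred_eq, mem_univ, iff_true]; linarith
    have e2 : Iic t ∩ Icc (0:ℝ) 1 = Icc 0 1 := by
      ext x
      simp only [mem_inter_iff, mem_Iic, mem_Icc, and_iff_right_iff_imp]
      rintro ⟨_, h2⟩; linarith
    rw [e1, e2]; simp

lemma q2_integral (m : Measure ℝ) [IsProbabilityMeasure m] (h : m ≪ volume) (g : ℝ → ℝ)
    (hg : Continuous g) (a : ℝ) :
    ∫ x in Iic a, g (ProbabilityTheory.cdf m x) ∂m
      = ∫ u in (0:ℝ)..(ProbabilityTheory.cdf m a), g u := by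
  have hm : Measurable (ProbabilityTheory.cdf m) := (q2_cont m h).measurable
  have h0 := ProbabilityTheory.cdf_nonneg m a
  have h1 := ProbabilityTheory.cdf_le_one m a
  have hae : Iic a =ᵐ[m] ProbabilityTheory.cdf m ⁻¹' Iic (ProbabilityTheory.cdf m a) := by
    refine ae_eq_of_subset_of_measure_ge ?_ ?_ measurableSet_Iic.nullMeasurableSet
      (measure_ne_top _ _)
    · intro x hx; exact (ProbabilityTheory.cdf m).mono hx
    · have := q2_le m h _ h0 h1
      rw [ProbabilityTheory.cdf_eq_real m a] at this
      refine ((measureReal_eq_measureReal_iff).1 ?_).le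
      rw [← ProbabilityTheory.cdf_eq_real m a] at this ⊢
      exact this
  rw [setIntegral_congr_set hae, ← setIntegral_map (f := g) measurableSet_Iic
    hg.aestronglyMeasurable hm.aemeasurable, q2_map m h,
    Measure.restrict_restrict measurableSet_Iic, intervalIntegral.integral_of_le h0,
    ← integral_Icc_eq_integral_Ioc]
  congr 2
  ext x
  simp only [mem_inter_iff, mem_Iic, mem_Icc]
  constructor
  · rintro ⟨a, b, c⟩; exact ⟨b, a⟩
  · rintro ⟨a, b⟩; exact ⟨b, a, b.trans h1⟩

lemma q2_ae (m : Measure ℝ) [IsProbabilityMeasure m] (f g : ℝ → ℝ) (hf : Integrable f m)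
    (hg : Integrable g m) (H : ∀ a, ∫ x in Iic a, f x ∂m = ∫ x in Iic a, g x ∂m) :
    f =ᵐ[m] g := by
  have huniv : ∫ x, f x ∂m = ∫ x, g x ∂m := by
    have t : ∀ k : ℝ → ℝ, Integrable k m →
        Tendsto (fun n : ℕ => ∫ x in Iic (n:ℝ), k x ∂m) atTop (nhds (∫ x, k x ∂m)) := by
      intro k hk
      have hu : (⋃ n : ℕ, Iic (n:ℝ)) = univ := by
        ext x; simpa using exists_nat_ge x
      have := tendsto_setIntegral_of_monotone (μ := m) (f := k) (s := fun n : ℕ => Iic (n:ℝ))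
        (fun _ => measurableSet_Iic) (fun i j hij => Iic_subset_Iic.2 (by exact_mod_cast hij))
        hk.integrableOn
      rwa [hu, setIntegral_univ] at this
    refine tendsto_nhds_unique (t f hf) ?_
    simp_rw [H]
    exact t g hg
  refine hf.ae_eq_of_forall_setIntegral_eq f g hg fun s hs _ => ?_
  induction s, hs using MeasurableSpace.induction_on_inter
    ((BorelSpace.measurable_eq (α := ℝ)).trans (borel_eq_generateFrom_Iic ℝ)) isPiSystem_Iic with
  | empty => simp
  | basic t ht => obtain ⟨a, rfl⟩ := ht; exact H a
  | compl t ht ih =>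
    have := ih (measure_lt_top _ _)
    have e1 := integral_add_compl ht hf
    have e2 := integral_add_compl ht hg
    linarith
  | iUnion s hd hs ih =>
    rw [integral_iUnion hs hd hf.integrableOn, integral_iUnion hs hd hg.integrableOn]
    exact tsum_congr fun i => ih i (measure_lt_top _ _)

/-- If `F₁`, `F₂` are absolutely continuous and the joint d.f. of `(ξ¹, ξ²)` is
`F₁₂(x,y) = C(F₁ x, F₂ y)` for a twice continuously differentiable copula `C`, then
`P(ξ¹ = 0) = P(ξ² = 0) = 0` and for every `z > 0`,
`F_{P³}(z) = P(ξ¹ > 0, ξ² > 0, ξ¹ + ξ² ≤ z)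
  = ∫₀^z [∂C/∂u(F₁ x₁, F₂ (z - x₁)) - ∂C/∂u(F₁ x₁, F₂ 0)] F₁(dx₁)`. -/
theorem quintuple_stmt2
    {Ω : Type*} [MeasurableSpace Ω] (ℙ : Measure Ω) [IsProbabilityMeasure ℙ]
    (ξ : Ω → ℝ × ℝ) (hξmeas : Measurable ξ)
    -- marginal distribution functions
    (F₁ F₂ : ℝ → ℝ)
    (hF₁ : ∀ a : ℝ, F₁ a = (ℙ {ω | (ξ ω).1 ≤ a}).toReal)
    (hF₂ : ∀ b : ℝ, F₂ b = (ℙ {ω | (ξ ω).2 ≤ b}).toReal)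
    -- absolute continuity of the marginal laws
    (hac₁ : ℙ.map (fun ω => (ξ ω).1) ≪ (volume : Measure ℝ))
    (hac₂ : ℙ.map (fun ω => (ξ ω).2) ≪ (volume : Measure ℝ))
    -- a twice continuously differentiable copula
    (C : ℝ → ℝ → ℝ) (hC : ContDiff ℝ 2 (Function.uncurry C))
    (hCgrounded : ∀ u ∈ Icc (0:ℝ) 1, C u 0 = 0 ∧ C 0 u = 0)
    (hCmargins : ∀ u ∈ Icc (0:ℝ) 1, C u 1 = u ∧ C 1 u = u)
    -- Sklar's representation of the joint distribution function
    (hSklar : ∀ a b : ℝ,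
      (ℙ {ω | (ξ ω).1 ≤ a ∧ (ξ ω).2 ≤ b}).toReal = C (F₁ a) (F₂ b)) :
    ℙ {ω | (ξ ω).1 = 0} = 0 ∧ ℙ {ω | (ξ ω).2 = 0} = 0 ∧
    ∀ z > (0:ℝ),
      (ℙ {ω | 0 < (ξ ω).1 ∧ 0 < (ξ ω).2 ∧ (ξ ω).1 + (ξ ω).2 ≤ z}).toReal
        = ∫ x₁ in Ioc (0:ℝ) z,
            (deriv (fun u => C u (F₂ (z - x₁))) (F₁ x₁)
              - deriv (fun u => C u (F₂ 0)) (F₁ x₁))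
            ∂(ℙ.map (fun ω => (ξ ω).1)) := by
  set ρ : Measure (ℝ × ℝ) := ℙ.map ξ with hρ
  have : IsProbabilityMeasure ρ := Measure.isProbabilityMeasure_map hξmeas.aemeasurable
  have hm1 : Measurable (fun ω => (ξ ω).1) := measurable_fst.comp hξmeas
  have hm2 : Measurable (fun ω => (ξ ω).2) := measurable_snd.comp hξmeas
  have hfst : ℙ.map (fun ω => (ξ ω).1) = ρ.fst := by
    rw [hρ, Measure.fst, Measure.map_map measurable_fst hξmeas]; rfl
  have hsnd : ℙ.map (fun ω => (ξ ω).2) = ρ.snd := by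
    rw [hρ, Measure.snd, Measure.map_map measurable_snd hξmeas]; rfl
  refine ⟨?_, ?_, ?_⟩
  · have := hac₁ (show volume {(0:ℝ)} = 0 by simp)
    rwa [Measure.map_apply hm1 (measurableSet_singleton 0)] at this
  · have := hac₂ (show volume {(0:ℝ)} = 0 by simp)
    rwa [Measure.map_apply hm2 (measurableSet_singleton 0)] at this
  rw [hfst] at hac₁ ⊢
  rw [hsnd] at hac₂
  have hF1 : F₁ = ProbabilityTheory.cdf ρ.fst := by
    funext a
    rw [hF₁, ProbabilityTheory.cdf_eq_real, ← hfst, measureReal_def,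
      Measure.map_apply hm1 measurableSet_Iic]; rfl
  have hF2 : F₂ = ProbabilityTheory.cdf ρ.snd := by
    funext a
    rw [hF₂, ProbabilityTheory.cdf_eq_real, ← hsnd, measureReal_def,
      Measure.map_apply hm2 measurableSet_Iic]; rfl
  have hc1 : Continuous F₁ := hF1 ▸ q2_cont _ hac₁
  have hc2 : Continuous F₂ := hF2 ▸ q2_cont _ hac₂
  -- the partial derivative
  set D : ℝ → ℝ → ℝ := fun v u => deriv (fun u => C u v) u with hD
  have hCdiff : Differentiable ℝ (Function.uncurry C) := hC.differentiable (by norm_num)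
  have hder : ∀ v u, HasDerivAt (fun u => C u v) (fderiv ℝ (Function.uncurry C) (u, v) (1, 0)) u := by
    intro v u
    have h1 : HasDerivAt (fun u : ℝ => (u, v)) ((1:ℝ), (0:ℝ)) u :=
      (hasDerivAt_id u).prodMk (hasDerivAt_const u v)
    exact (hCdiff (u, v)).hasFDerivAt.comp_hasDerivAt u h1
  have hDeq : ∀ v u, D v u = fderiv ℝ (Function.uncurry C) (u, v) (1, 0) :=
    fun v u => (hder v u).deriv
  have hDcont : Continuous (fun p : ℝ × ℝ => D p.1 p.2) := by
    simp_rw [hDeq]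
    have hfc : Continuous (fderiv ℝ (Function.uncurry C)) := hC.continuous_fderiv (by norm_num)
    exact (hfc.comp (continuous_snd.prodMk continuous_fst)).clm_apply continuous_const
  have hDv : ∀ v, Continuous (D v) := fun v => hDcont.comp (continuous_const.prodMk continuous_id)
  have hF1mem : ∀ a, F₁ a ∈ Icc (0:ℝ) 1 := fun a => by
    rw [hF1]; exact ⟨ProbabilityTheory.cdf_nonneg _ _, ProbabilityTheory.cdf_le_one _ _⟩
  have hF2mem : ∀ a, F₂ a ∈ Icc (0:ℝ) 1 := fun a => by
    rw [hF2]; exact ⟨ProbabilityTheory.cdf_nonneg _ _, ProbabilityTheory.cdf_le_one _ _⟩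
  have hDint : ∀ v, Integrable (fun x => D v (F₁ x)) ρ.fst := by
    intro v
    obtain ⟨M, hM⟩ := (isCompact_Icc (a := (0:ℝ)) (b := 1)).exists_bound_of_continuousOn
      (hDv v).continuousOn
    exact Integrable.of_bound ((hDv v).comp hc1).aestronglyMeasurable M
      (Eventually.of_forall fun x => hM _ (hF1mem x))
  have hκmeas : ∀ s, MeasurableSet s → Measurable (fun x => ρ.condKernel x s) :=
    fun s hs => ProbabilityTheory.Kernel.measurable_coe _ hs
  have hκint : ∀ s, MeasurableSet s → Integrable (fun x => (ρ.condKernel x).real s) ρ.fst := by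
    intro s hs
    refine Integrable.of_bound (hκmeas s hs).ennreal_toReal.aestronglyMeasurable 1
      (Eventually.of_forall fun x => ?_)
    rw [Real.norm_of_nonneg measureReal_nonneg]
    exact measureReal_le_one
  have key : ∀ y, (fun x => (ρ.condKernel x).real (Iic y)) =ᵐ[ρ.fst] fun x => D (F₂ y) (F₁ x) := by
    intro y
    refine q2_ae _ _ _ (hκint _ measurableSet_Iic) (hDint _) fun a => ?_
    have e1 : ∫ x in Iic a, (ρ.condKernel x).real (Iic y) ∂ρ.fst = ρ.real (Iic a ×ˢ Iic y) := by
      simp_rw [measureReal_def]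
      rw [integral_toReal (hκmeas _ measurableSet_Iic).aemeasurable
        (Eventually.of_forall fun x => measure_lt_top _ _),
        Measure.setLIntegral_condKernel_eq_measure_prod measurableSet_Iic measurableSet_Iic]
    have e2 : ρ.real (Iic a ×ˢ Iic y) = C (F₁ a) (F₂ y) := by
      rw [← hSklar, measureReal_def, hρ,
        Measure.map_apply hξmeas (measurableSet_Iic.prod measurableSet_Iic)]; rfl
    have e3 := q2_integral ρ.fst hac₁ (D (F₂ y)) (hDv _) a
    rw [← hF1] at e3
    rw [e1, e2, e3, intervalIntegral.integral_eq_sub_of_hasDerivAt (f := fun u => C u (F₂ y))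
      (fun x _ => (hDeq (F₂ y) x) ▸ hder (F₂ y) x) ((hDv _).intervalIntegrable _ _),
      (hCgrounded _ (hF2mem y)).2, sub_zero]
  have key2 : ∀ᵐ x ∂ρ.fst, ∀ y, (ρ.condKernel x).real (Iic y) = D (F₂ y) (F₁ x) := by
    have : ∀ᵐ x ∂ρ.fst, ∀ q : ℚ, (ρ.condKernel x).real (Iic (q:ℝ)) = D (F₂ q) (F₁ x) :=
      ae_all_iff.2 fun q => key q
    filter_upwards [this] with x hx y
    obtain ⟨u, -, hu, hut⟩ := Real.exists_seq_rat_strictAnti_tendsto y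
    have t1 : Tendsto (fun n => ProbabilityTheory.cdf (ρ.condKernel x) (u n)) atTop
        (nhds (ProbabilityTheory.cdf (ρ.condKernel x) y)) := by
      refine ((ProbabilityTheory.cdf (ρ.condKernel x)).right_continuous y).tendsto.comp ?_
      exact tendsto_nhdsWithin_iff.2 ⟨hut, Eventually.of_forall fun n => (hu n).le⟩
    have t2 : Tendsto (fun n => D (F₂ (u n)) (F₁ x)) atTop (nhds (D (F₂ y) (F₁ x))) := by
      have : Continuous fun y => D (F₂ y) (F₁ x) := hDcont.comp (hc2.prodMk continuous_const)
      exact (this.tendsto y).comp hut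
    simp_rw [ProbabilityTheory.cdf_eq_real, hx] at t1
    exact tendsto_nhds_unique t1 t2
  intro z hz
  set S : Set (ℝ × ℝ) := {p | 0 < p.1 ∧ 0 < p.2 ∧ p.1 + p.2 ≤ z} with hS
  have hSm : MeasurableSet S :=
    (measurableSet_lt measurable_const measurable_fst).inter
      ((measurableSet_lt measurable_const measurable_snd).inter
        (measurableSet_le (measurable_fst.add measurable_snd) measurable_const))
  have hl : ℙ {ω | 0 < (ξ ω).1 ∧ 0 < (ξ ω).2 ∧ (ξ ω).1 + (ξ ω).2 ≤ z} = ρ S := by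
    rw [hρ, Measure.map_apply hξmeas hSm]; rfl
  have hmeasS : Measurable (fun x => ρ.condKernel x {y | (x, y) ∈ S}) :=
    ProbabilityTheory.Kernel.measurable_kernel_prodMk_left hSm
  rw [hl, ← Measure.lintegral_condKernel_mem hSm, ← integral_toReal
    hmeasS.aemeasurable
    (Eventually.of_forall fun x => measure_lt_top _ _), ← integral_indicator measurableSet_Ioc]
  refine integral_congr_ae ?_
  filter_upwards [key2] with x hx
  by_cases hxz : x ∈ Ioc 0 z
  · rw [indicator_of_mem hxz]
    have e : {y | (x, y) ∈ S} = Iic (z - x) \ Iic 0 := by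
      ext y
      simp only [hS, mem_ofPred_eq, Set.mem_sdiff, mem_Iic, not_le]
      constructor
      · rintro ⟨_, h2, h3⟩; exact ⟨by linarith, h2⟩
      · rintro ⟨h1, h2⟩; exact ⟨hxz.1, h2, by linarith⟩
    rw [e, ← measureReal_def, measureReal_sdiff (Iic_subset_Iic.2 (by linarith [hxz.2]))
      measurableSet_Iic, hx, hx]
  · rw [indicator_of_notMem hxz]
    have e : {y | (x, y) ∈ S} = ∅ := by
      ext y
      simp only [hS, mem_ofPred_eq, mem_empty_iff_false, iff_false]
      rintro ⟨h1, h2, h3⟩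
      exact hxz ⟨h1, by linarith⟩
    rw [e]; simp
end

section
/- If F₁ and F₂ are absolutely continuous and the joint d.f. of (ξ¹, ξ²) is F₁₂(x, y) = C(F₁(x), F₂(y)) for a twice continuously differentiable copula C, then for every z > 0 the mixed-sign-jump sub-distribution functions satisfy F_{P⁴}(z) := P(ξ¹ > 0, ξ² < 0, ξ¹ + ξ² ≤ z) = ∫_{(−∞,0)} [ ∂C/∂v (F₁(z − x₂), F₂(x₂)) − ∂C/∂v (F₁(0), F₂(x₂)) ] F₂(dx₂) and F_{P⁵}(z) := P(ξ¹ < 0, ξ² > 0, ξ¹ + ξ² ≤ z) = ∫_{(−∞,0)} [ ∂C/∂u (F₁(x₁), F₂(z − x₁)) − ∂C/∂u (F₁(x₁), F₂(0)) ] F₁(dx₁). -/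
open MeasureTheory Set Filter


lemma aux_cdf_continuous (μ : Measure ℝ) [IsProbabilityMeasure μ] (h : ∀ a, μ {a} = 0) :
    Continuous (ProbabilityTheory.cdf μ) := by
  rw [continuous_iff_continuousAt]
  intro a
  have h1 := (ProbabilityTheory.cdf μ).measure_singleton a
  rw [ProbabilityTheory.measure_cdf, h a] at h1
  have h2 := ENNReal.ofReal_eq_zero.1 h1.symm
  rw [(ProbabilityTheory.monotone_cdf μ).continuousAt_iff_leftLim_eq_rightLim,
    StieltjesFunction.rightLim_eq]
  exact le_antisymm ((ProbabilityTheory.monotone_cdf μ).leftLim_le le_rfl) (by linarith)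

lemma aux_cdf_surj (μ : Measure ℝ) [IsProbabilityMeasure μ] (h : ∀ a, μ {a} = 0)
    (t : ℝ) (h0 : 0 < t) (h1 : t < 1) : ∃ b, ProbabilityTheory.cdf μ b = t := by
  have := mem_range_of_exists_le_of_exists_ge (c := t) (aux_cdf_continuous μ h)
    (((ProbabilityTheory.tendsto_cdf_atBot μ).eventually (Iio_mem_nhds h0)).exists.imp
      fun _ h => le_of_lt h)
    (((ProbabilityTheory.tendsto_cdf_atTop μ).eventually (Ioi_mem_nhds h1)).exists.imp
      fun _ h => le_of_lt h)
  exact this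

lemma aux_pit_real (μ : Measure ℝ) [IsProbabilityMeasure μ] (h : ∀ a, μ {a} = 0)
    (t : ℝ) (h1 : t < 1) : μ.real {y | ProbabilityTheory.cdf μ y ≤ t} = max t 0 := by
  apply le_antisymm
  · apply le_of_forall_gt_imp_ge_of_dense
    intro s hs
    rcases le_or_gt 1 s with hs1 | hs1
    · exact measureReal_le_one.trans hs1
    · obtain ⟨b, hb⟩ := aux_cdf_surj μ h s (lt_of_le_of_lt (le_max_right _ _) hs) hs1
      rw [← hb, ProbabilityTheory.cdf_eq_real]
      apply measureReal_mono _ (measure_ne_top _ _)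
      intro y hy
      by_contra hyb
      have := ProbabilityTheory.monotone_cdf μ (le_of_lt (not_le.1 hyb))
      have h3 := lt_of_le_of_lt (le_max_left t 0) hs
      simp only [mem_ofPred_eq] at hy
      linarith
  · apply max_le _ measureReal_nonneg
    rcases le_or_gt t 0 with h0 | h0
    · exact h0.trans measureReal_nonneg
    · obtain ⟨b, hb⟩ := aux_cdf_surj μ h t h0 h1
      conv_lhs => rw [← hb, ProbabilityTheory.cdf_eq_real]
      apply measureReal_mono _ (measure_ne_top _ _)
      intro y hy
      simp only [mem_ofPred_eq]
      rw [← hb]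
      exact ProbabilityTheory.monotone_cdf μ hy

lemma aux_pit (μ : Measure ℝ) [IsProbabilityMeasure μ] (h : ∀ a, μ {a} = 0) :
    μ.map (ProbabilityTheory.cdf μ) = (volume : Measure ℝ).restrict (Ioc 0 1) := by
  have hm : Measurable (ProbabilityTheory.cdf μ) := (aux_cdf_continuous μ h).measurable
  have : IsProbabilityMeasure (μ.map (ProbabilityTheory.cdf μ)) :=
    Measure.isProbabilityMeasure_map hm.aemeasurable
  apply Measure.ext_of_Iic
  intro t
  rw [Measure.map_apply hm measurableSet_Iic, Measure.restrict_apply measurableSet_Iic]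
  rcases le_or_gt 1 t with ht | ht
  · have e1 : (ProbabilityTheory.cdf μ) ⁻¹' Iic t = univ := by
      ext y; simpa using (ProbabilityTheory.cdf_le_one μ y).trans ht
    have e2 : Iic t ∩ Ioc (0:ℝ) 1 = Ioc 0 1 := by
      apply inter_eq_right.2; intro x hx; exact hx.2.trans ht
    rw [e1, e2]; simp
  · have e2 : Iic t ∩ Ioc (0:ℝ) 1 = Ioc 0 t := by
      ext x; simp only [mem_inter_iff, mem_Iic, mem_Ioc]; grind
    rw [e2, Real.volume_Ioc, ← ENNReal.ofReal_toReal (measure_ne_top μ _)]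
    have := aux_pit_real μ h t ht
    rw [measureReal_def] at this
    have e : (ProbabilityTheory.cdf μ) ⁻¹' Iic t = {y | ProbabilityTheory.cdf μ y ≤ t} := rfl
    rw [e, this, sub_zero]
    rcases le_total t 0 with h0 | h0
    · rw [max_eq_right h0, ENNReal.ofReal_of_nonpos h0]; simp
    · rw [max_eq_left h0]

lemma aux_ftc (μ : Measure ℝ) [IsProbabilityMeasure μ] (h : ∀ a, μ {a} = 0)
    (c : ℝ → ℝ) (hc : ContDiff ℝ 1 c) (b : ℝ) :
    ∫ y in Iic b, deriv c (ProbabilityTheory.cdf μ y) ∂μ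
      = c (ProbabilityTheory.cdf μ b) - c 0 := by
  have hm : Measurable (ProbabilityTheory.cdf μ) := (aux_cdf_continuous μ h).measurable
  set G := ProbabilityTheory.cdf μ with hG
  have hd : Continuous (deriv c) := hc.continuous_deriv le_rfl
  have hsub : Iic b ⊆ G ⁻¹' Iic (G b) := fun y hy => ProbabilityTheory.monotone_cdf μ hy
  have hmeq : μ (G ⁻¹' Iic (G b)) ≤ μ (Iic b) := by
    rw [← ENNReal.toReal_le_toReal (measure_ne_top _ _) (measure_ne_top _ _)]
    change μ.real _ ≤ μ.real _
    rw [← ProbabilityTheory.cdf_eq_real, ← hG]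
    rcases (ProbabilityTheory.cdf_le_one μ b).lt_or_eq with h1 | h1
    · have := aux_pit_real μ h (G b) h1
      rw [max_eq_left (ProbabilityTheory.cdf_nonneg μ b)] at this
      exact this.le
    · rw [← hG] at h1; rw [h1]; exact measureReal_le_one
  have hae := ae_eq_of_subset_of_measure_ge hsub hmeq measurableSet_Iic.nullMeasurableSet
    (measure_ne_top _ _)
  rw [setIntegral_congr_set hae,
    ← setIntegral_map measurableSet_Iic hd.aestronglyMeasurable hm.aemeasurable, aux_pit μ h,
    Measure.restrict_restrict measurableSet_Iic]
  have e2 : Iic (G b) ∩ Ioc (0:ℝ) 1 = Ioc 0 (G b) := by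
    have := ProbabilityTheory.cdf_le_one μ b
    ext x; simp only [mem_inter_iff, mem_Iic, mem_Ioc]; grind
  rw [e2, ← intervalIntegral.integral_of_le (ProbabilityTheory.cdf_nonneg μ b)]
  exact intervalIntegral.integral_deriv_eq_sub
    (fun x _ => (hc.differentiable one_ne_zero) x) (hd.intervalIntegrable _ _)

lemma aux_ae_zero (μ : Measure ℝ) [IsProbabilityMeasure μ] (f : ℝ → ℝ) (hf : Integrable f μ)
    (h0 : ∀ b, ∫ y in Iic b, f y ∂μ = 0) : f =ᵐ[μ] 0 := by
  have hu : ∫ y, f y ∂μ = 0 := by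
    have hU : (⋃ n : ℕ, Iic (n : ℝ)) = univ := by
      ext x; simpa using exists_nat_ge x
    have := tendsto_setIntegral_of_monotone (μ := μ) (f := f) (s := fun n : ℕ => Iic (n : ℝ))
      (fun _ => measurableSet_Iic) (fun i j hij => Iic_subset_Iic.2 (by exact_mod_cast hij))
      hf.integrableOn
    simp only [h0, hU, setIntegral_univ] at this
    exact tendsto_nhds_unique this tendsto_const_nhds
  apply hf.ae_eq_zero_of_forall_setIntegral_eq_zero
  intro s hs _
  induction s, hs using MeasurableSpace.induction_on_inter
    (borel_eq_generateFrom_Iic ℝ ▸ BorelSpace.measurable_eq) isPiSystem_Iic with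
  | empty => simp
  | basic t ht => obtain ⟨b, rfl⟩ := ht; exact h0 b
  | compl t htm ih =>
    have := integral_add_compl htm hf
    rw [ih (measure_lt_top _ _), hu] at this; linarith
  | iUnion g hd hg ih =>
    rw [integral_iUnion hg hd hf.integrableOn]
    simp [fun i => ih i (measure_lt_top _ _)]

/-- The general half of the statement. -/
lemma aux_key {Ω : Type*} [MeasurableSpace Ω] (ℙ : Measure Ω) [IsProbabilityMeasure ℙ]
    (X Y : Ω → ℝ) (hX : Measurable X) (hY : Measurable Y) (F G : ℝ → ℝ)
    (hF : ∀ a : ℝ, F a = (ℙ {ω | X ω ≤ a}).toReal)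
    (hG : ∀ b : ℝ, G b = (ℙ {ω | Y ω ≤ b}).toReal)
    (hac₁ : ℙ.map X ≪ (volume : Measure ℝ))
    (hac₂ : ℙ.map Y ≪ (volume : Measure ℝ))
    (C : ℝ → ℝ → ℝ) (hC : ContDiff ℝ 2 (Function.uncurry C))
    (hC0 : ∀ u ∈ Icc (0:ℝ) 1, C u 0 = 0)
    (hSklar : ∀ a b : ℝ, (ℙ {ω | X ω ≤ a ∧ Y ω ≤ b}).toReal = C (F a) (G b))
    (z : ℝ) (hz : 0 < z) :
    (ℙ {ω | 0 < X ω ∧ Y ω < 0 ∧ X ω + Y ω ≤ z}).toReal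
        = ∫ y in Iio (0:ℝ), (deriv (fun v => C (F (z - y)) v) (G y)
              - deriv (fun v => C (F 0) v) (G y)) ∂(ℙ.map Y) := by
  have pX : IsProbabilityMeasure (ℙ.map X) := Measure.isProbabilityMeasure_map hX.aemeasurable
  have pY : IsProbabilityMeasure (ℙ.map Y) := Measure.isProbabilityMeasure_map hY.aemeasurable
  have aX : ∀ a, ℙ.map X {a} = 0 := fun a => hac₁ Real.volume_singleton
  have aY : ∀ a, ℙ.map Y {a} = 0 := fun a => hac₂ Real.volume_singleton
  have eF : F = ProbabilityTheory.cdf (ℙ.map X) := by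
    ext a
    rw [hF, ProbabilityTheory.cdf_eq_real, measureReal_def, Measure.map_apply hX measurableSet_Iic]
    rfl
  have eG : G = ProbabilityTheory.cdf (ℙ.map Y) := by
    ext a
    rw [hG, ProbabilityTheory.cdf_eq_real, measureReal_def, Measure.map_apply hY measurableSet_Iic]
    rfl
  have cF : Continuous F := eF ▸ aux_cdf_continuous _ aX
  have cG : Continuous G := eG ▸ aux_cdf_continuous _ aY
  have hCu : ∀ u, ContDiff ℝ 2 (C u) := fun u =>
    hC.comp (contDiff_const.prodMk contDiff_id : ContDiff ℝ 2 fun v : ℝ => (u, v))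
  have cD : Continuous (fun p : ℝ × ℝ => deriv (C p.1) p.2) := by
    have e : (fun p : ℝ × ℝ => deriv (C p.1) p.2)
        = fun p => fderiv ℝ (Function.uncurry C) p ((0:ℝ), (1:ℝ)) := by
      ext p
      have h1 : HasFDerivAt (Function.uncurry C) (fderiv ℝ (Function.uncurry C) p) (p.1, p.2) :=
        ((hC.differentiable two_ne_zero) p).hasFDerivAt
      have h2 : HasDerivAt (fun v : ℝ => (p.1, v)) ((0:ℝ), (1:ℝ)) p.2 :=
        (hasDerivAt_const _ _).prodMk (hasDerivAt_id _)
      exact (h1.comp_hasDerivAt p.2 h2).deriv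
    rw [e]
    exact (hC.continuous_fderiv two_ne_zero).clm_apply continuous_const
  set ρ : Measure (ℝ × ℝ) := ℙ.map (fun ω => (Y ω, X ω)) with hρ
  have hYX : Measurable (fun ω => (Y ω, X ω)) := hY.prodMk hX
  have pρ : IsProbabilityMeasure ρ := Measure.isProbabilityMeasure_map hYX.aemeasurable
  have hfst : ρ.fst = ℙ.map Y := Measure.fst_map_prodMk hX
  set κ := ρ.condKernel with hκ
  have mκ : ∀ s, MeasurableSet s → Measurable (fun y => (κ y).real s) := fun s hs =>
    (κ.measurable_coe hs).ennreal_toReal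
  have iκ : ∀ s, MeasurableSet s → Integrable (fun y => (κ y).real s) (ℙ.map Y) := fun s hs =>
    Integrable.of_bound (mκ s hs).aestronglyMeasurable 1
      (Eventually.of_forall fun y => by
        rw [Real.norm_of_nonneg measureReal_nonneg]; exact measureReal_le_one)
  have bG : ∀ y, G y ∈ Icc (0:ℝ) 1 := fun y => by
    rw [eG]; exact ⟨ProbabilityTheory.cdf_nonneg _ _, ProbabilityTheory.cdf_le_one _ _⟩
  have bF : ∀ y, F y ∈ Icc (0:ℝ) 1 := fun y => by
    rw [eF]; exact ⟨ProbabilityTheory.cdf_nonneg _ _, ProbabilityTheory.cdf_le_one _ _⟩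
  have key : ∀ a : ℝ, ∀ᵐ y ∂(ℙ.map Y), (κ y).real (Iic a) = deriv (C (F a)) (G y) := by
    intro a
    have cd : Continuous (deriv (C (F a))) := (hCu _).continuous_deriv one_le_two
    have i2 : Integrable (fun y => deriv (C (F a)) (G y)) (ℙ.map Y) := by
      obtain ⟨M, hM⟩ := (isCompact_Icc (a := (0:ℝ)) (b := 1)).exists_bound_of_continuousOn
        cd.continuousOn
      exact Integrable.of_bound (cd.comp cG).aestronglyMeasurable M
        (Eventually.of_forall fun y => hM _ (bG y))
    have := aux_ae_zero (ℙ.map Y) (fun y => (κ y).real (Iic a) - deriv (C (F a)) (G y))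
      ((iκ _ measurableSet_Iic).sub i2) (by
        intro b
        rw [integral_sub (iκ _ measurableSet_Iic).integrableOn i2.integrableOn]
        have e1 : ∫ y in Iic b, (κ y).real (Iic a) ∂(ℙ.map Y) = C (F a) (G b) := by
          rw [← hSklar]
          simp only [measureReal_def]
          rw [integral_toReal (κ.measurable_coe measurableSet_Iic).aemeasurable
            (Eventually.of_forall fun y => measure_lt_top _ _), ← hfst, hκ,
            Measure.setLIntegral_condKernel_eq_measure_prod measurableSet_Iic measurableSet_Iic,
            hρ, Measure.map_apply hYX (measurableSet_Iic.prod measurableSet_Iic)]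
          congr 2
          ext ω; simp [and_comm]
        have e2 := aux_ftc (ℙ.map Y) aY (C (F a)) ((hCu _).of_le one_le_two) b
        rw [← eG, hC0 _ (bF a)] at e2
        rw [e1, e2]; ring)
    filter_upwards [this] with y hy
    simpa [sub_eq_zero] using hy
  have key2 : ∀ᵐ y ∂(ℙ.map Y), ∀ a : ℝ, (κ y).real (Iic a) = deriv (C (F a)) (G y) := by
    have : ∀ᵐ y ∂(ℙ.map Y), ∀ q : ℚ, (κ y).real (Iic (q:ℝ)) = deriv (C (F q)) (G y) :=
      ae_all_iff.2 fun q => key q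
    filter_upwards [this] with y hy a
    have r1 : ContinuousWithinAt (fun x => (κ y).real (Iic x)) (Ioi a) a := by
      have := (ProbabilityTheory.cdf (κ y)).right_continuous a
      simp only [← ProbabilityTheory.cdf_eq_real]
      exact this.mono Ioi_subset_Ici_self
    have r2 : ContinuousWithinAt (fun x => deriv (C (F x)) (G y)) (Ioi a) a :=
      (cD.comp (cF.prodMk (continuous_const (y := G y)))).continuousWithinAt
    obtain ⟨q, -, hq, hql⟩ :=
      Rat.denseRange_cast.exists_seq_strictAnti_tendsto Rat.cast_strictMono.monotone a
    have hw : Tendsto (fun n => (q n : ℝ)) atTop (nhdsWithin a (Ioi a)) :=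
      tendsto_nhdsWithin_iff.2 ⟨hql, Eventually.of_forall hq⟩
    have t1 := r1.tendsto.comp hw
    have t2 := r2.tendsto.comp hw
    refine tendsto_nhds_unique t1 (t2.congr fun n => ?_)
    exact (hy (q n)).symm
  have hS : MeasurableSet {p : ℝ × ℝ | 0 < p.2 ∧ p.1 < 0 ∧ p.2 + p.1 ≤ z} := by
    refine (measurableSet_lt measurable_const measurable_snd).inter
      ((measurableSet_lt measurable_fst measurable_const).inter
        (measurableSet_le (measurable_snd.add measurable_fst) measurable_const))
  have hL := Measure.lintegral_condKernel_mem (ρ := ρ) hS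
  have hP : ρ {p : ℝ × ℝ | 0 < p.2 ∧ p.1 < 0 ∧ p.2 + p.1 ≤ z}
      = ℙ {ω | 0 < X ω ∧ Y ω < 0 ∧ X ω + Y ω ≤ z} := by
    rw [hρ, Measure.map_apply hYX hS]; rfl
  rw [← hP, ← hL, hfst, ← integral_indicator measurableSet_Iio, ← integral_toReal]
  · apply integral_congr_ae
    filter_upwards [key2] with y hy
    by_cases hy0 : y < 0
    · rw [indicator_of_mem (by exact hy0)]
      have e : {x : ℝ | 0 < x ∧ y < 0 ∧ x + y ≤ z}
          = Iic (z - y) \ Iic 0 := by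
        ext x; simp only [mem_ofPred_eq, Set.mem_sdiff, mem_Iic, not_le]; grind
      rw [e, ← measureReal_def, measureReal_sdiff (Iic_subset_Iic.2 (by linarith)) measurableSet_Iic,
        hy, hy]
    · rw [indicator_of_notMem (by exact hy0)]
      simp [hy0]
  · exact (ProbabilityTheory.Kernel.measurable_kernel_prodMk_left hS).aemeasurable
  · exact Eventually.of_forall fun y => measure_lt_top _ _

/-- Mixed-sign-jump sub-distribution functions under a twice continuously
differentiable copula `C` coupling the absolutely continuous margins:
for every `z > 0`,
`F_{P⁴}(z) = P(ξ¹ > 0, ξ² < 0, ξ¹ + ξ² ≤ z)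
  = ∫_{(-∞,0)} [∂C/∂v(F₁ (z - x₂), F₂ x₂) - ∂C/∂v(F₁ 0, F₂ x₂)] F₂(dx₂)` and
`F_{P⁵}(z) = P(ξ¹ < 0, ξ² > 0, ξ¹ + ξ² ≤ z)
  = ∫_{(-∞,0)} [∂C/∂u(F₁ x₁, F₂ (z - x₁)) - ∂C/∂u(F₁ x₁, F₂ 0)] F₁(dx₁)`. -/
theorem quintuple_stmt3
    {Ω : Type*} [MeasurableSpace Ω] (ℙ : Measure Ω) [IsProbabilityMeasure ℙ]
    (ξ : Ω → ℝ × ℝ) (hξmeas : Measurable ξ)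
    -- marginal distribution functions
    (F₁ F₂ : ℝ → ℝ)
    (hF₁ : ∀ a : ℝ, F₁ a = (ℙ {ω | (ξ ω).1 ≤ a}).toReal)
    (hF₂ : ∀ b : ℝ, F₂ b = (ℙ {ω | (ξ ω).2 ≤ b}).toReal)
    -- absolute continuity of the marginal laws
    (hac₁ : ℙ.map (fun ω => (ξ ω).1) ≪ (volume : Measure ℝ))
    (hac₂ : ℙ.map (fun ω => (ξ ω).2) ≪ (volume : Measure ℝ))
    -- a twice continuously differentiable copula
    (C : ℝ → ℝ → ℝ) (hC : ContDiff ℝ 2 (Function.uncurry C))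
    (hCgrounded : ∀ u ∈ Icc (0:ℝ) 1, C u 0 = 0 ∧ C 0 u = 0)
    (hCmargins : ∀ u ∈ Icc (0:ℝ) 1, C u 1 = u ∧ C 1 u = u)
    -- Sklar's representation of the joint distribution function
    (hSklar : ∀ a b : ℝ,
      (ℙ {ω | (ξ ω).1 ≤ a ∧ (ξ ω).2 ≤ b}).toReal = C (F₁ a) (F₂ b)) :
    ∀ z > (0:ℝ),
      (ℙ {ω | 0 < (ξ ω).1 ∧ (ξ ω).2 < 0 ∧ (ξ ω).1 + (ξ ω).2 ≤ z}).toReal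
        = ∫ x₂ in Iio (0:ℝ),
            (deriv (fun v => C (F₁ (z - x₂)) v) (F₂ x₂)
              - deriv (fun v => C (F₁ 0) v) (F₂ x₂))
            ∂(ℙ.map (fun ω => (ξ ω).2)) ∧
      (ℙ {ω | (ξ ω).1 < 0 ∧ 0 < (ξ ω).2 ∧ (ξ ω).1 + (ξ ω).2 ≤ z}).toReal
        = ∫ x₁ in Iio (0:ℝ),
            (deriv (fun u => C u (F₂ (z - x₁))) (F₁ x₁)
              - deriv (fun u => C u (F₂ 0)) (F₁ x₁))
            ∂(ℙ.map (fun ω => (ξ ω).1)) := by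
  intro z hz
  refine ⟨aux_key ℙ (fun ω => (ξ ω).1) (fun ω => (ξ ω).2) hξmeas.fst hξmeas.snd F₁ F₂ hF₁ hF₂
    hac₁ hac₂ C hC (fun u hu => (hCgrounded u hu).1) hSklar z hz, ?_⟩
  have h := aux_key ℙ (fun ω => (ξ ω).2) (fun ω => (ξ ω).1) hξmeas.snd hξmeas.fst F₂ F₁ hF₂ hF₁
    hac₂ hac₁ (fun u v => C v u)
    (hC.comp (contDiff_snd.prodMk contDiff_fst : ContDiff ℝ 2 fun p : ℝ × ℝ => (p.2, p.1)))
    (fun u hu => (hCgrounded u hu).2)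
    (fun a b => by rw [← hSklar b a]; congr 2; ext ω; exact and_comm) z hz
  refine Eq.trans ?_ h
  congr 2
  ext ω
  simp only [mem_ofPred_eq]
  rw [add_comm]
  tauto
end

section
/- Single-jump tail integrals under a Lévy copula: for every z > 0, Π( (z,∞) × {0} ) = Π̄₁(z) − lim_{y↓0} Ĉ(Π̄₁(z), Π̄₂(y)) + lim_{y↑0} Ĉ(Π̄₁(z), Π̄₂(y)), and symmetrically Π( {0} × (z,∞) ) = Π̄₂(z) − lim_{x↓0} Ĉ(Π̄₁(x), Π̄₂(z)) + lim_{x↑0} Ĉ(Π̄₁(x), Π̄₂(z)). -/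
open MeasureTheory Set Filter

/-- Mass of a finite measure at the origin through its one-sided tails. -/
lemma atom_of_tails (ν : Measure ℝ) [IsFiniteMeasure ν] (a b : ℝ)
    (ha : Tendsto (fun y => (ν (Ioi y)).toReal) (nhdsWithin 0 (Ioi 0)) (nhds a))
    (hb : Tendsto (fun y => -(ν (Iic y)).toReal) (nhdsWithin 0 (Iio 0)) (nhds b)) :
    (ν {0}).toReal = (ν univ).toReal - a + b := by
  have hu : Tendsto (fun n : ℕ => 1 / ((n : ℝ) + 1)) atTop (nhds 0) :=
    tendsto_one_div_add_atTop_nhds_zero_nat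
  have hpos : ∀ n : ℕ, 0 < 1 / ((n : ℝ) + 1) := fun n => by positivity
  have hup : Tendsto (fun n : ℕ => 1 / ((n : ℝ) + 1)) atTop (nhdsWithin 0 (Ioi 0)) :=
    tendsto_nhdsWithin_iff.2 ⟨hu, Eventually.of_forall hpos⟩
  have hum : Tendsto (fun n : ℕ => -(1 / ((n : ℝ) + 1))) atTop (nhdsWithin 0 (Iio 0)) := by
    refine tendsto_nhdsWithin_iff.2 ⟨by simpa using hu.neg, Eventually.of_forall fun n => ?_⟩
    have := hpos n
    simp only [mem_Iio]; linarith
  have h1 := ((tendsto_const_nhds (x := (ν univ).toReal)).sub (ha.comp hup)).add (hb.comp hum)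
  have hanti : Antitone fun n : ℕ => Ioc (-(1 / ((n : ℝ) + 1))) (1 / ((n : ℝ) + 1)) := by
    intro m n hmn
    have h : 1 / ((n : ℝ) + 1) ≤ 1 / ((m : ℝ) + 1) := Nat.one_div_le_one_div hmn
    exact Ioc_subset_Ioc (by linarith) h
  have hI : (⋂ n : ℕ, Ioc (-(1 / ((n : ℝ) + 1))) (1 / ((n : ℝ) + 1))) = {0} := by
    ext x
    simp only [mem_iInter, mem_Ioc, mem_singleton_iff]
    constructor
    · intro h
      have h2 : x ≤ 0 := ge_of_tendsto' hu fun n => (h n).2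
      have h3 : -0 ≤ x := le_of_tendsto' hu.neg fun n => (h n).1.le
      linarith
    · rintro rfl n
      have := hpos n
      constructor <;> linarith
  have h2 := tendsto_measure_iInter_atTop (μ := ν)
    (fun n : ℕ => (measurableSet_Ioc
      (a := -(1 / ((n : ℝ) + 1))) (b := 1 / ((n : ℝ) + 1))).nullMeasurableSet)
    hanti ⟨0, measure_ne_top _ _⟩
  rw [hI] at h2
  have h3 := (ENNReal.tendsto_toReal (measure_ne_top ν {0})).comp h2
  refine tendsto_nhds_unique h3 (h1.congr fun n => ?_)
  have hn := hpos n
  set u := 1 / ((n : ℝ) + 1)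
  simp only [Function.comp]
  change ν.real univ - ν.real (Ioi u) + -ν.real (Iic (-u)) = ν.real (Ioc (-u) u)
  have e1 : ν.real (Iic u) + ν.real (Ioi u) = ν.real univ := by
    have := measureReal_add_measureReal_compl (μ := ν) (measurableSet_Iic (a := u))
    rwa [compl_Iic] at this
  have e2 : ν.real (Iic u) = ν.real (Iic (-u)) + ν.real (Ioc (-u) u) := by
    rw [← Iic_union_Ioc_eq_Iic (show -u ≤ u by linarith)]
    exact measureReal_union (Iic_disjoint_Ioc le_rfl) measurableSet_Ioc
  linarith

/-- A Lévy measure is finite away from the origin. -/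
lemma levy_finite (μJ : Measure (ℝ × ℝ))
    (hfin : ∫⁻ p, ENNReal.ofReal (min 1 (‖p‖ ^ 2)) ∂μJ ≠ ⊤) (z : ℝ) (hz : 0 < z)
    (S : Set (ℝ × ℝ)) (hS : ∀ p ∈ S, z ≤ ‖p‖) : μJ S < ⊤ := by
  have hc : 0 < min 1 (z ^ 2) := by positivity
  have h := meas_ge_le_lintegral_div (μ := μJ)
    (f := fun p => ENNReal.ofReal (min 1 (‖p‖ ^ 2)))
    (by fun_prop) (ε := ENNReal.ofReal (min 1 (z ^ 2)))
    (ENNReal.ofReal_pos.2 hc).ne' ENNReal.ofReal_ne_top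
  refine lt_of_le_of_lt ((measure_mono fun p hp => ?_).trans h)
    (ENNReal.div_lt_top hfin (ENNReal.ofReal_pos.2 hc).ne')
  have := hS p hp
  simp only [mem_setOf_eq]
  exact ENNReal.ofReal_le_ofReal (by gcongr)

/-- Single-jump tail integrals under a Lévy copula: for every `z > 0`,
`Π((z,∞) × {0}) = Π̄₁(z) - lim_{y↓0} Ĉ(Π̄₁ z, Π̄₂ y) + lim_{y↑0} Ĉ(Π̄₁ z, Π̄₂ y)` and
`Π({0} × (z,∞)) = Π̄₂(z) - lim_{x↓0} Ĉ(Π̄₁ x, Π̄₂ z) + lim_{x↑0} Ĉ(Π̄₁ x, Π̄₂ z)`.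
Here `μJ` plays the role of the bivariate Lévy measure `Π`, `μ₁, μ₂` its marginals,
`T₁, T₂` the marginal tail integrals, `Tb` the quadrantwise joint tail integral and
`Chat` the Lévy copula. -/
theorem quintuple_stmt10
    (μJ : Measure (ℝ × ℝ))
    -- bivariate Lévy measure
    (hfin : ∫⁻ p, ENNReal.ofReal (min 1 (‖p‖ ^ 2)) ∂μJ ≠ ⊤)
    (h0 : μJ {((0:ℝ), (0:ℝ))} = 0)
    -- marginal measures, assumed absolutely continuous
    (μ₁ μ₂ : Measure ℝ)
    (hμ₁ : ∀ A : Set ℝ, MeasurableSet A → μ₁ A = μJ ((A \ {0}) ×ˢ (univ : Set ℝ)))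
    (hμ₂ : ∀ A : Set ℝ, MeasurableSet A → μ₂ A = μJ ((univ : Set ℝ) ×ˢ (A \ {0})))
    (hac₁ : μ₁ ≪ (volume : Measure ℝ)) (hac₂ : μ₂ ≪ (volume : Measure ℝ))
    -- marginal tail integrals
    (T₁ T₂ : ℝ → ℝ)
    (hT₁p : ∀ x > (0:ℝ), T₁ x = (μ₁ (Ioi x)).toReal)
    (hT₁m : ∀ x < (0:ℝ), T₁ x = -(μ₁ (Iic x)).toReal)
    (hT₂p : ∀ x > (0:ℝ), T₂ x = (μ₂ (Ioi x)).toReal)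
    (hT₂m : ∀ x < (0:ℝ), T₂ x = -(μ₂ (Iic x)).toReal)
    -- quadrantwise joint tail integral
    (Tb : ℝ → ℝ → ℝ)
    (hTbpp : ∀ x₁ > (0:ℝ), ∀ x₂ > (0:ℝ), Tb x₁ x₂ = (μJ (Ioi x₁ ×ˢ Ioi x₂)).toReal)
    (hTbpm : ∀ x₁ > (0:ℝ), ∀ x₂ < (0:ℝ), Tb x₁ x₂ = -(μJ (Ioi x₁ ×ˢ Iic x₂)).toReal)
    (hTbmp : ∀ x₁ < (0:ℝ), ∀ x₂ > (0:ℝ), Tb x₁ x₂ = -(μJ (Iic x₁ ×ˢ Ioi x₂)).toReal)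
    (hTbmm : ∀ x₁ < (0:ℝ), ∀ x₂ < (0:ℝ), Tb x₁ x₂ = (μJ (Iic x₁ ×ˢ Iic x₂)).toReal)
    -- twice continuously differentiable Lévy copula and Sklar's theorem
    (Chat : ℝ → ℝ → ℝ) (hChat : ContDiff ℝ 2 (Function.uncurry Chat))
    (hSklar : ∀ x₁ x₂ : ℝ, x₁ ≠ 0 → x₂ ≠ 0 → Tb x₁ x₂ = Chat (T₁ x₁) (T₂ x₂))
    -- the one-sided limits appearing in the statement exist
    (Lp Lm Mp Mm : ℝ → ℝ)
    (hLp : ∀ z > (0:ℝ), Tendsto (fun y => Chat (T₁ z) (T₂ y)) (nhdsWithin 0 (Ioi 0)) (nhds (Lp z)))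
    (hLm : ∀ z > (0:ℝ), Tendsto (fun y => Chat (T₁ z) (T₂ y)) (nhdsWithin 0 (Iio 0)) (nhds (Lm z)))
    (hMp : ∀ z > (0:ℝ), Tendsto (fun x => Chat (T₁ x) (T₂ z)) (nhdsWithin 0 (Ioi 0)) (nhds (Mp z)))
    (hMm : ∀ z > (0:ℝ), Tendsto (fun x => Chat (T₁ x) (T₂ z)) (nhdsWithin 0 (Iio 0)) (nhds (Mm z))) :
    ∀ z > (0:ℝ),
      (μJ (Ioi z ×ˢ ({0} : Set ℝ))).toReal = T₁ z - Lp z + Lm z ∧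
      (μJ (({0} : Set ℝ) ×ˢ Ioi z)).toReal = T₂ z - Mp z + Mm z := by
  intro z hz
  constructor
  · have hf : μJ (Ioi z ×ˢ univ) < ⊤ := by
      refine levy_finite μJ hfin z hz _ fun p hp => ?_
      have h1 : z < p.1 := hp.1
      exact (h1.le.trans (le_abs_self _)).trans (norm_fst_le p)
    have : Fact (μJ (Ioi z ×ˢ univ) < ⊤) := ⟨hf⟩
    have key : ∀ A : Set ℝ, MeasurableSet A →
        ((μJ.restrict (Ioi z ×ˢ univ)).map Prod.snd) A = μJ (Ioi z ×ˢ A) := by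
      intro A hA
      rw [Measure.map_apply measurable_snd hA, Measure.restrict_apply (measurable_snd hA)]
      congr 1
      ext p
      simp [and_comm]
    have hd : Ioi z \ {0} = Ioi z := diff_singleton_eq_self (by simp [hz.le])
    have := atom_of_tails ((μJ.restrict (Ioi z ×ˢ univ)).map Prod.snd) (Lp z) (Lm z)
      ((hLp z hz).congr' (by
        filter_upwards [self_mem_nhdsWithin] with y hy
        rw [key _ measurableSet_Ioi, ← hTbpp z hz y hy, hSklar z y hz.ne' (ne_of_gt hy)]))
      ((hLm z hz).congr' (by
        filter_upwards [self_mem_nhdsWithin] with y hy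
        rw [key _ measurableSet_Iic, ← hTbpm z hz y hy, hSklar z y hz.ne' (ne_of_lt hy)]))
    rwa [key _ (measurableSet_singleton 0), key _ MeasurableSet.univ, ← hd,
      ← hμ₁ _ measurableSet_Ioi, ← hT₁p z hz, hd] at this
  · have hf : μJ (univ ×ˢ Ioi z) < ⊤ := by
      refine levy_finite μJ hfin z hz _ fun p hp => ?_
      have h1 : z < p.2 := hp.2
      exact (h1.le.trans (le_abs_self _)).trans (norm_snd_le p)
    have : Fact (μJ (univ ×ˢ Ioi z) < ⊤) := ⟨hf⟩
    have key : ∀ A : Set ℝ, MeasurableSet A →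
        ((μJ.restrict (univ ×ˢ Ioi z)).map Prod.fst) A = μJ (A ×ˢ Ioi z) := by
      intro A hA
      rw [Measure.map_apply measurable_fst hA, Measure.restrict_apply (measurable_fst hA)]
      congr 1
      ext p
      simp
    have hd : Ioi z \ {0} = Ioi z := diff_singleton_eq_self (by simp [hz.le])
    have := atom_of_tails ((μJ.restrict (univ ×ˢ Ioi z)).map Prod.fst) (Mp z) (Mm z)
      ((hMp z hz).congr' (by
        filter_upwards [self_mem_nhdsWithin] with y hy
        rw [key _ measurableSet_Ioi, ← hTbpp y hy z hz, hSklar y z (ne_of_gt hy) hz.ne']))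
      ((hMm z hz).congr' (by
        filter_upwards [self_mem_nhdsWithin] with y hy
        rw [key _ measurableSet_Iic, ← hTbmp y hy z hz, hSklar y z (ne_of_lt hy) hz.ne']))
    rwa [key _ (measurableSet_singleton 0), key _ MeasurableSet.univ, ← hd,
      ← hμ₂ _ measurableSet_Ioi, ← hT₂p z hz, hd] at this
end

section
/- Tail integrals of mixed-sign joint jumps under a Lévy copula: for every z > 0, Π( { (x, y) : x > 0, y < 0, x + y > z } ) = ∫_{(z,∞)} [ ∂Ĉ/∂u ( Π̄₁(x), Π̄₂(z − x) ) − ∂Ĉ/∂u ( Π̄₁(x), lim_{a↑0} Π̄₂(a) ) ] Π₁(dx), and Π( { (x, y) : x < 0, y > 0, x + y > z } ) = ∫_{(z,∞)} [ ∂Ĉ/∂v ( Π̄₁(z − y), Π̄₂(y) ) − ∂Ĉ/∂v ( lim_{a↑0} Π̄₁(a), Π̄₂(y) ) ] Π₂(dy). -/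
open MeasureTheory Set Filter

lemma q_tail_tendsto (m : Measure ℝ) [IsFiniteMeasure m] [NullSingletonClass m] :
    Continuous (fun x => m.real (Ioi x)) := by
  rw [continuous_iff_continuousAt]
  intro x0
  have h : Tendsto (fun x => m (Ioi x)) (nhds x0) (nhds (m (Ioi x0))) := by
    apply tendsto_measure_of_ae_tendsto_indicator_of_isFiniteMeasure (nhds x0) measurableSet_Ioi
      (fun _ => measurableSet_Ioi)
    have : ∀ᵐ s ∂m, s ≠ x0 := by
      rw [ae_iff]; simp
    filter_upwards [this] with s hs
    rcases lt_or_gt_of_ne hs with h | h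
    · filter_upwards [lt_mem_nhds h] with x hx
      simp only [mem_Ioi]
      constructor <;> intro <;> linarith
    · filter_upwards [gt_mem_nhds h] with x hx
      simp only [mem_Ioi]
      constructor <;> intro <;> linarith
  exact (ENNReal.tendsto_toReal (measure_ne_top _ _)).comp h

lemma q_tail_zero (m : Measure ℝ) [IsFiniteMeasure m] :
    Tendsto (fun x => m.real (Ioi x)) atTop (nhds 0) := by
  have h : Tendsto (fun x => m (Ioi x)) atTop (nhds (m ∅)) := by
    apply tendsto_measure_of_ae_tendsto_indicator_of_isFiniteMeasure atTop MeasurableSet.empty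
      (fun _ => measurableSet_Ioi)
    refine Eventually.of_forall fun s => ?_
    filter_upwards [eventually_ge_atTop s] with x hx
    simp [hx]
  simpa [Function.comp_def, measureReal_def] using (ENNReal.tendsto_toReal (measure_ne_top _ _)).comp h

lemma q_anti (m : Measure ℝ) [IsFiniteMeasure m] : Antitone (fun x => m.real (Ioi x)) :=
  fun _ _ h => measureReal_mono (Ioi_subset_Ioi h)

lemma q_map (m : Measure ℝ) [IsFiniteMeasure m] [NullSingletonClass m] (x : ℝ) :
    (m.restrict (Ioi x)).map (fun s => m.real (Ioi s))
      = (volume : Measure ℝ).restrict (Ioc 0 (m.real (Ioi x))) := by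
  have hc := q_tail_tendsto m
  have hz := q_tail_zero m
  have ha := q_anti m
  set R : ℝ → ℝ := fun x => m.real (Ioi x) with hR
  have hRm : Measurable R := hc.measurable
  have hRx : ∀ s, m (Ioi s) = ENNReal.ofReal (R s) := fun s => by
    simp [hR]
  have ivt : ∀ t, 0 < t → t < R x → ∃ s, x < s ∧ R s = t := by
    intro t h0 h1
    obtain ⟨y, hy, hxy⟩ := ((hz.eventually (gt_mem_nhds h0)).and (eventually_ge_atTop x)).exists
    obtain ⟨s, hs, hst⟩ := intermediate_value_Icc' hxy hc.continuousOn ⟨hy.le, h1.le⟩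
    refine ⟨s, lt_of_le_of_ne hs.1 ?_, hst⟩
    rintro rfl
    linarith
  haveI : IsFiniteMeasure ((volume : Measure ℝ).restrict (Ioc 0 (R x))) := ⟨by simp⟩
  apply Measure.ext_of_Iic
  intro t
  rw [Measure.map_apply hRm measurableSet_Iic, Measure.restrict_apply (hRm measurableSet_Iic),
    Measure.restrict_apply measurableSet_Iic]
  have hv : Iic t ∩ Ioc 0 (R x) = Ioc 0 (min t (R x)) := by
    ext y; simp only [mem_inter_iff, mem_Iic, mem_Ioc, le_min_iff]; tauto
  rw [hv, Real.volume_Ioc, sub_zero]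
  rcases lt_or_ge t 0 with h0 | h0
  · have : R ⁻¹' Iic t ∩ Ioi x = ∅ := by
      ext s
      simp only [mem_inter_iff, mem_preimage, mem_Iic, mem_empty_iff_false, iff_false, not_and]
      intro h; have : 0 ≤ R s := measureReal_nonneg
      linarith
    rw [this, measure_empty, ENNReal.ofReal_of_nonpos]
    exact (min_le_left _ _).trans h0.le
  rcases le_or_gt (R x) t with h1 | h1
  · have : R ⁻¹' Iic t ∩ Ioi x = Ioi x := by
      apply inter_eq_right.2
      intro s hs
      exact (ha (le_of_lt hs)).trans h1
    rw [this, min_eq_right h1, hRx]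
  rw [min_eq_left h1.le]
  apply le_antisymm
  · have key : ∀ t', t < t' → t' < R x → m (R ⁻¹' Iic t ∩ Ioi x) ≤ ENNReal.ofReal t' := by
      intro t' h2 h3
      obtain ⟨s, hs, rfl⟩ := ivt t' (h0.trans_lt h2) h3
      rw [← hRx]
      apply measure_mono
      rintro y ⟨hy, -⟩
      by_contra hys
      have h4 : R s ≤ R y := ha (not_lt.1 hys)
      have h5 : R y ≤ t := hy
      linarith
    have hlim : Tendsto ENNReal.ofReal (nhdsWithin t (Ioi t)) (nhds (ENNReal.ofReal t)) :=
      (ENNReal.continuous_ofReal.tendsto t).mono_left nhdsWithin_le_nhds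
    refine ge_of_tendsto hlim ?_
    filter_upwards [Ioo_mem_nhdsGT h1] with t' ht'
    exact key t' ht'.1 ht'.2
  · rcases h0.eq_or_lt with rfl | h0
    · simp
    obtain ⟨s, hs, rfl⟩ := ivt t h0 h1
    rw [← hRx]
    apply measure_mono
    intro y hy
    exact ⟨ha (le_of_lt hy), hs.trans hy⟩

lemma q_ftc (m : Measure ℝ) [IsFiniteMeasure m] [NullSingletonClass m] (x : ℝ) (φ φ' : ℝ → ℝ)
    (hφ : ∀ u, HasDerivAt φ (φ' u) u) (hc : Continuous φ') :
    ∫ s in Ioi x, φ' (m.real (Ioi s)) ∂m = φ (m.real (Ioi x)) - φ 0 := by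
  have h1 := integral_map (μ := m.restrict (Ioi x)) (φ := fun s => m.real (Ioi s))
    (q_tail_tendsto m).measurable.aemeasurable (f := φ') hc.aestronglyMeasurable
  rw [← h1, q_map, ← intervalIntegral.integral_of_le measureReal_nonneg]
  exact intervalIntegral.integral_eq_sub_of_hasDerivAt (fun u _ => hφ u) (hc.intervalIntegrable _ _)

lemma q_core (ρ : Measure (ℝ × ℝ)) [IsFiniteMeasure ρ] (m : Measure ℝ) [IsFiniteMeasure m]
    [NullSingletonClass m] (C : ℝ → ℝ → ℝ) (hC : ContDiff ℝ 2 (Function.uncurry C))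
    (G : ℝ → ℝ) (hG : Continuous G) (K : ℝ) (hK : ∀ b, |G b| ≤ K) (g : ℝ) (z : ℝ)
    (w : ℝ) (hw1 : ρ (Iic w ×ˢ univ) = 0) (hw2 : m (Iic w) = 0)
    (h : ∀ x b, ρ.real (Ioi x ×ˢ Ioi b) = C (m.real (Ioi x)) (G b) - C (m.real (Ioi x)) g) :
    ρ.real {p | z < p.1 + p.2} =
      ∫ s, (deriv (fun u => C u (G (z - s))) (m.real (Ioi s))
        - deriv (fun u => C u g) (m.real (Ioi s))) ∂m := by
  set D : ℝ → ℝ → ℝ := fun u v => deriv (fun u => C u v) u with hD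
  have hdiff : ∀ u v, HasDerivAt (fun u => C u v) (fderiv ℝ (Function.uncurry C) (u, v) (1, 0)) u := by
    intro u v
    have h1 : HasFDerivAt (Function.uncurry C) (fderiv ℝ (Function.uncurry C) (u, v)) (u, v) :=
      (hC.differentiable (by norm_num) _).hasFDerivAt
    have h2 : HasDerivAt (fun u : ℝ => (u, v)) ((1:ℝ), (0:ℝ)) u :=
      (hasDerivAt_id u).prodMk (hasDerivAt_const u v)
    exact h1.comp_hasDerivAt u h2
  have hDeq : ∀ u v, D u v = fderiv ℝ (Function.uncurry C) (u, v) (1, 0) :=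
    fun u v => (hdiff u v).deriv
  have hDd : ∀ u v, HasDerivAt (fun u => C u v) (D u v) u := fun u v => by
    rw [hDeq]; exact hdiff u v
  have hDc : Continuous (fun p : ℝ × ℝ => D p.1 p.2) := by
    simp only [hDeq]
    exact (hC.continuous_fderiv (by norm_num)).clm_apply continuous_const
  have hRc := q_tail_tendsto m
  set R : ℝ → ℝ := fun x => m.real (Ioi x) with hR
  set F : ℝ → ℝ → ℝ := fun s b => D (R s) (G b) - D (R s) g with hF
  have hFc : Continuous (fun p : ℝ × ℝ => F p.1 p.2) := by
    have e1 : Continuous (fun p : ℝ × ℝ => D (R p.1) (G p.2)) :=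
      hDc.comp ((hRc.comp continuous_fst).prodMk (hG.comp continuous_snd))
    have e2 : Continuous (fun p : ℝ × ℝ => D (R p.1) g) :=
      hDc.comp ((hRc.comp continuous_fst).prodMk continuous_const)
    exact e1.sub e2
  obtain ⟨B, hB⟩ : ∃ B, ∀ s b, ‖F s b‖ ≤ B := by
    have hcomp : IsCompact (Icc 0 (m.real univ) ×ˢ Icc (-K) K) := isCompact_Icc.prod isCompact_Icc
    obtain ⟨B1, hB1⟩ := hcomp.exists_bound_of_continuousOn hDc.continuousOn
    have hcomp : IsCompact (Icc 0 (m.real univ) ×ˢ {g}) := isCompact_Icc.prod isCompact_singleton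
    obtain ⟨B2, hB2⟩ := hcomp.exists_bound_of_continuousOn hDc.continuousOn
    refine ⟨B1 + B2, fun s b => ?_⟩
    have hr : R s ∈ Icc 0 (m.real univ) := ⟨measureReal_nonneg, measureReal_mono (subset_univ _)⟩
    exact (norm_sub_le _ _).trans
      (add_le_add (hB1 (R s, G b) ⟨hr, abs_le.1 (hK b)⟩) (hB2 (R s, g) ⟨hr, rfl⟩))
  have hFint : ∀ b : ℝ → ℝ, Measurable b → Integrable (fun s => F s (b s)) m := by
    intro b hb
    refine Integrable.of_bound (C := B) ?_ (Eventually.of_forall fun s => hB _ _)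
    exact (hFc.measurable.comp (measurable_id.prodMk hb)).aestronglyMeasurable
  -- value at zero
  have hφ0 : ∀ b, C 0 (G b) - C 0 g = 0 := by
    intro b
    have hz := q_tail_zero m
    have hCc := hC.continuous
    have t1 : Tendsto (fun x => C (R x) (G b) - C (R x) g) atTop (nhds (C 0 (G b) - C 0 g)) := by
      have e1 : Continuous fun u => C u (G b) - C u g := by
        have a1 : Continuous fun u => C u (G b) := hCc.comp (continuous_id.prodMk continuous_const)
        have a2 : Continuous fun u => C u g := hCc.comp (continuous_id.prodMk continuous_const)
        exact a1.sub a2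
      exact (e1.tendsto 0).comp hz
    have t2 : Tendsto (fun x => ρ.real (Ioi x ×ˢ Ioi b)) atTop (nhds 0) := by
      have h : Tendsto (fun x => ρ (Ioi x ×ˢ Ioi b)) atTop (nhds (ρ ∅)) := by
        apply tendsto_measure_of_ae_tendsto_indicator_of_isFiniteMeasure atTop MeasurableSet.empty
          (fun _ => measurableSet_Ioi.prod measurableSet_Ioi)
        refine Eventually.of_forall fun s => ?_
        filter_upwards [eventually_ge_atTop s.1] with x hx
        simp [hx]
      simpa [Function.comp_def, measureReal_def] using (ENNReal.tendsto_toReal (measure_ne_top _ _)).comp h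
    have t3 : Tendsto (fun x => C (R x) (G b) - C (R x) g) atTop (nhds 0) := by
      simpa only [h] using t2
    exact tendsto_nhds_unique t1 t3
  have hIoi : ∀ b x, ρ.real (Ioi x ×ˢ Ioi b) = ∫ s in Ioi x, F s b ∂m := by
    intro b x
    have := q_ftc m x (fun u => C u (G b) - C u g) (fun u => D u (G b) - D u g)
      (fun u => (hDd u _).sub (hDd u _))
      ((hDc.comp (continuous_id.prodMk continuous_const)).sub
        (hDc.comp (continuous_id.prodMk continuous_const)))
    rw [h, this, hφ0 b, sub_zero]
  have huniv : ∀ b, ρ.real (univ ×ˢ Ioi b) = ∫ s, F s b ∂m := by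
    intro b
    have e1 : ρ.real (univ ×ˢ Ioi b) = ρ.real (Ioi w ×ˢ Ioi b) := by
      apply measureReal_congr
      have : ∀ᵐ p ∂ρ, p ∉ Iic w ×ˢ (univ : Set ℝ) := measure_eq_zero_iff_ae_notMem.1 hw1
      filter_upwards [this] with p hp
      have hp' : w < p.1 := by simpa using hp
      apply propext
      change (p ∈ (univ : Set ℝ) ×ˢ Ioi b) ↔ (p ∈ Ioi w ×ˢ Ioi b)
      simp [hp']
    rw [e1, hIoi, setIntegral_eq_integral_of_ae_compl_eq_zero]
    have : ∀ᵐ p ∂m, p ∉ Iic w := measure_eq_zero_iff_ae_notMem.1 hw2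
    filter_upwards [this] with p hp hp2
    simp at hp hp2
    linarith
  have hall : ∀ b A, MeasurableSet A → ρ.real (A ×ˢ Ioi b) = ∫ s in A, F s b ∂m := by
    intro b A hA
    have hi : Integrable (fun s => F s b) m := hFint (fun _ => b) measurable_const
    induction A, hA using MeasurableSpace.induction_on_inter
      (borel_eq_generateFrom_Ioi ℝ ▸ (BorelSpace.measurable_eq (α := ℝ))) isPiSystem_Ioi with
    | empty => simp
    | basic t ht =>
      obtain ⟨x, rfl⟩ := ht
      exact hIoi b x
    | compl t ht ih =>
      have e : tᶜ ×ˢ Ioi b = (univ ×ˢ Ioi b) \ (t ×ˢ Ioi b) := by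
        ext p; simp only [mem_prod, mem_compl_iff, mem_diff, mem_univ]; tauto
      rw [e, measureReal_diff (by gcongr; exact subset_univ t) (ht.prod measurableSet_Ioi),
        huniv, ih, setIntegral_compl ht hi]
    | iUnion f hd hf ih =>
      have e : (⋃ i, f i) ×ˢ Ioi b = ⋃ i, (f i ×ˢ Ioi b) := iUnion_prod_const
      have hdd : Pairwise (Function.onFun Disjoint fun i => f i ×ˢ Ioi b) := by
        intro i j hij
        exact (hd hij).set_prod_left _ _
      rw [e, integral_iUnion hf hd hi.integrableOn, measureReal_def,
        measure_iUnion hdd (fun i => (hf i).prod measurableSet_Ioi),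
        ENNReal.tsum_toReal_eq (fun _ => measure_ne_top _ _)]
      exact tsum_congr ih
  -- staircases
  set bn : ℕ → ℝ → ℝ := fun n s => (⌈(z - s) * (n + 1)⌉ : ℝ) / (n + 1) with hbn
  have hkm : ∀ n : ℕ, Measurable fun s : ℝ => ⌈(z - s) * ((n:ℝ) + 1)⌉ := fun n =>
    Int.measurable_ceil.comp ((measurable_const.sub measurable_id).mul_const _)
  have hbm : ∀ n, Measurable (bn n) := fun n =>
    ((measurable_of_countable (fun k : ℤ => (k:ℝ))).comp (hkm n)).div_const _
  have hble : ∀ n s, z - s ≤ bn n s := by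
    intro n s
    have : (0:ℝ) < n + 1 := by positivity
    rw [hbn, le_div_iff₀ this]
    exact Int.le_ceil _
  have hbt : ∀ s, Tendsto (fun n => bn n s) atTop (nhds (z - s)) := by
    intro s
    have hu : ∀ n, bn n s ≤ (z - s) + 1 / ((n:ℝ) + 1) := by
      intro n
      have : (0:ℝ) < n + 1 := by positivity
      have h2 := (Int.ceil_lt_add_one ((z - s) * ((n:ℝ) + 1))).le
      rw [hbn]
      calc (⌈(z - s) * ((n:ℝ) + 1)⌉ : ℝ) / (n + 1) ≤ ((z - s) * ((n:ℝ) + 1) + 1) / (n + 1) := by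
            gcongr
        _ = _ := by field_simp
    refine tendsto_of_tendsto_of_tendsto_of_le_of_le tendsto_const_nhds ?_
      (fun n => hble n s) hu
    simpa using tendsto_const_nhds.add (tendsto_one_div_add_atTop_nhds_zero_nat (𝕜 := ℝ))
  have hstep : ∀ n, ρ.real {p | bn n p.1 < p.2} = ∫ s, F s (bn n s) ∂m := by
    intro n
    set E : ℤ → Set ℝ := fun k => (fun s : ℝ => ⌈(z - s) * ((n:ℝ) + 1)⌉) ⁻¹' {k} with hE
    have hEm : ∀ k, MeasurableSet (E k) := fun k => hkm n (measurableSet_singleton k)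
    have hEd : Pairwise (Function.onFun Disjoint E) := by
      intro i j hij
      exact Disjoint.preimage _ (disjoint_singleton.2 hij)
    have hEu : ⋃ k, E k = univ := by
      ext s; simp [hE]
    have e : {p : ℝ × ℝ | bn n p.1 < p.2} = ⋃ k, (E k ×ˢ Ioi ((k:ℝ) / (n + 1))) := by
      ext p
      simp [hE, hbn]
    have hdd : Pairwise (Function.onFun Disjoint fun k : ℤ => E k ×ˢ Ioi ((k:ℝ) / ((n:ℝ) + 1))) := by
      intro i j hij
      exact (hEd hij).set_prod_left _ _
    rw [← setIntegral_univ, ← hEu, integral_iUnion hEm hEd (hFint _ (hbm n)).integrableOn, e,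
      measureReal_def, measure_iUnion hdd (fun i => (hEm i).prod measurableSet_Ioi),
        ENNReal.tsum_toReal_eq (fun _ => measure_ne_top _ _)]
    refine tsum_congr fun k => ?_
    refine (hall _ _ (hEm k)).trans ?_
    refine setIntegral_congr_fun (hEm k) fun s hs => ?_
    have : ⌈(z - s) * ((n:ℝ) + 1)⌉ = k := hs
    simp only [hbn, this]
  have l1 : Tendsto (fun n => ρ.real {p | bn n p.1 < p.2}) atTop
      (nhds (ρ.real {p | z < p.1 + p.2})) := by
    have h : Tendsto (fun n => ρ {p | bn n p.1 < p.2}) atTop (nhds (ρ {p | z < p.1 + p.2})) := by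
      apply tendsto_measure_of_ae_tendsto_indicator_of_isFiniteMeasure atTop
        (measurableSet_lt measurable_const (measurable_fst.add measurable_snd))
        (fun n => measurableSet_lt ((hbm n).comp measurable_fst) measurable_snd)
      refine Eventually.of_forall fun p => ?_
      by_cases hp : z < p.1 + p.2
      · have : z - p.1 < p.2 := by linarith
        filter_upwards [(hbt p.1).eventually (gt_mem_nhds this)] with n hn
        exact ⟨fun _ => hp, fun _ => hn⟩
      · refine Eventually.of_forall fun n => ⟨fun h => ?_, fun h => absurd h hp⟩
        have h1 := hble n p.1
        have h2 : bn n p.1 < p.2 := h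
        exact absurd (show z < p.1 + p.2 by linarith) hp
    exact (ENNReal.tendsto_toReal (measure_ne_top _ _)).comp h
  have l2 : Tendsto (fun n => ∫ s, F s (bn n s) ∂m) atTop (nhds (∫ s, F s (z - s) ∂m)) := by
    refine tendsto_integral_of_dominated_convergence (fun _ => B)
      (fun n => (hFint _ (hbm n)).aestronglyMeasurable) (integrable_const _)
      (fun n => Eventually.of_forall fun s => hB _ _) (Eventually.of_forall fun s => ?_)
    have : Continuous fun b => F s b := hFc.comp (continuous_const.prodMk continuous_id)
    exact (this.tendsto _).comp (hbt s)
  simp only [hstep] at l1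
  exact tendsto_nhds_unique l1 l2

lemma q_half (μJ : Measure (ℝ × ℝ))
    (hfin : ∫⁻ p, ENNReal.ofReal (min 1 (‖p‖ ^ 2)) ∂μJ ≠ ⊤)
    (μ₁ μ₂ : Measure ℝ)
    (hμ₁ : ∀ A : Set ℝ, MeasurableSet A → μ₁ A = μJ ((A \ {0}) ×ˢ (univ : Set ℝ)))
    (hμ₂ : ∀ A : Set ℝ, MeasurableSet A → μ₂ A = μJ ((univ : Set ℝ) ×ˢ (A \ {0})))
    (hac₁ : μ₁ ≪ (volume : Measure ℝ)) (hac₂ : μ₂ ≪ (volume : Measure ℝ))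
    (T₁ T₂ : ℝ → ℝ)
    (hT₁p : ∀ x > (0:ℝ), T₁ x = (μ₁ (Ioi x)).toReal)
    (hT₂m : ∀ x < (0:ℝ), T₂ x = -(μ₂ (Iic x)).toReal)
    (C : ℝ → ℝ → ℝ) (hC : ContDiff ℝ 2 (Function.uncurry C))
    (hS : ∀ x > (0:ℝ), ∀ y < (0:ℝ), -(μJ (Ioi x ×ˢ Iic y)).toReal = C (T₁ x) (T₂ y))
    (l₂ : ℝ) (hl₂ : Tendsto T₂ (nhdsWithin 0 (Iio 0)) (nhds l₂)) (z : ℝ) (hz : 0 < z) :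
    (μJ {p : ℝ × ℝ | 0 < p.1 ∧ p.2 < 0 ∧ z < p.1 + p.2}).toReal
        = ∫ x in Ioi z,
            (deriv (fun u => C u (T₂ (z - x))) (T₁ x)
              - deriv (fun u => C u l₂) (T₁ x)) ∂μ₁ := by
  have hε : ∀ ε > (0:ℝ), μJ {p | ε ≤ ‖p‖} < ⊤ := by
    intro ε hε
    have hc : ENNReal.ofReal (min 1 (ε ^ 2)) ≠ 0 := by
      have : 0 < min 1 (ε ^ 2) := by positivity
      exact (ENNReal.ofReal_pos.2 this).ne'
    have hmeas : Measurable fun p : ℝ × ℝ => ENNReal.ofReal (min 1 (‖p‖ ^ 2)) := by fun_prop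
    have h1 := meas_ge_le_lintegral_div (μ := μJ) hmeas.aemeasurable hc ENNReal.ofReal_ne_top
    refine lt_of_le_of_lt (le_trans (measure_mono ?_) h1) (ENNReal.div_lt_top hfin hc)
    intro p hp
    have hp' : ε ≤ ‖p‖ := hp
    simp only [mem_setOf_eq]
    gcongr
  have hf1 : ∀ x > (0:ℝ), μJ (Ioi x ×ˢ univ) < ⊤ := by
    intro x hx
    refine lt_of_le_of_lt (measure_mono ?_) (hε x hx)
    rintro p ⟨hp, -⟩
    have hp' : x < p.1 := hp
    have : |p.1| ≤ ‖p‖ := norm_fst_le p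
    have := le_abs_self p.1
    simp only [mem_setOf_eq]; linarith
  have hf2 : ∀ y < (0:ℝ), μJ (univ ×ˢ Iic y) < ⊤ := by
    intro y hy
    refine lt_of_le_of_lt (measure_mono ?_) (hε (-y) (by linarith))
    rintro p ⟨-, hp⟩
    have hp' : p.2 ≤ y := hp
    have : |p.2| ≤ ‖p‖ := norm_snd_le p
    have := neg_le_abs p.2
    simp only [mem_setOf_eq]; linarith
  have hm1 : ∀ x > (0:ℝ), μ₁ (Ioi x) = μJ (Ioi x ×ˢ univ) := by
    intro x hx
    rw [hμ₁ _ measurableSet_Ioi, diff_singleton_eq_self]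
    simp [hx.le]
  have hm2 : ∀ y < (0:ℝ), μ₂ (Iic y) = μJ (univ ×ˢ Iic y) := by
    intro x hx
    rw [hμ₂ _ measurableSet_Iic, diff_singleton_eq_self]
    simp [hx]
  -- the total mass of the negative half-line
  have hn : μ₂ (Iio 0) = ENNReal.ofReal (-l₂) := by
    have s0 : Tendsto (fun k : ℕ => -(1 / ((k:ℝ) + 1))) atTop (nhds 0) := by
      simpa using (tendsto_one_div_add_atTop_nhds_zero_nat (𝕜 := ℝ)).neg
    have hneg : ∀ k : ℕ, -(1 / ((k:ℝ) + 1)) < 0 := fun k => by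
      have : 0 < 1 / ((k:ℝ) + 1) := by positivity
      linarith
    have s1 : Tendsto (fun k : ℕ => -(1 / ((k:ℝ) + 1))) atTop (nhdsWithin 0 (Iio 0)) :=
      tendsto_nhdsWithin_iff.2 ⟨s0, Eventually.of_forall hneg⟩
    have e1 : Tendsto (fun k : ℕ => ENNReal.ofReal (-T₂ (-(1 / ((k:ℝ) + 1))))) atTop
        (nhds (ENNReal.ofReal (-l₂))) := ENNReal.tendsto_ofReal ((hl₂.comp s1).neg)
    have hmono : Monotone fun k : ℕ => Iic (-(1 / ((k:ℝ) + 1))) := by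
      intro a b hab
      apply Iic_subset_Iic.2
      have : 1 / ((b:ℝ) + 1) ≤ 1 / ((a:ℝ) + 1) := Nat.one_div_le_one_div hab
      linarith
    have e2 := tendsto_measure_iUnion_atTop (μ := μ₂) hmono
    have e3 : (⋃ k : ℕ, Iic (-(1 / ((k:ℝ) + 1)))) = Iio 0 := by
      ext y
      simp only [mem_iUnion, mem_Iic, mem_Iio]
      constructor
      · rintro ⟨k, hk⟩; exact hk.trans_lt (hneg k)
      · intro hy
        exact ((s0.eventually (lt_mem_nhds hy)).exists).imp fun k hk => le_of_lt hk
    rw [e3] at e2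
    refine tendsto_nhds_unique e2 (e1.congr fun k => ?_)
    rw [hT₂m _ (hneg k), neg_neg, ENNReal.ofReal_toReal]
    · rfl
    · rw [hm2 _ (hneg k)]; exact (hf2 _ (hneg k)).ne
  have hna1 : ∀ x, μ₁ {x} = 0 := fun x => hac₁ (by simp)
  have hna2 : ∀ x, μ₂ {x} = 0 := fun x => hac₂ (by simp)
  have hdisj : Iic z ∩ Ioi z = ∅ := by
    ext y; simp
  set n := μ₂.restrict (Iio 0) with hndef
  set m := μ₁.restrict (Ioi z) with hmdef
  haveI : IsFiniteMeasure n := ⟨by rw [hndef, Measure.restrict_apply_univ, hn]; simp⟩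
  haveI : IsFiniteMeasure m := ⟨by rw [hmdef, Measure.restrict_apply_univ, hm1 z hz]; exact hf1 z hz⟩
  haveI : NullSingletonClass n := ⟨fun x =>
    le_antisymm ((Measure.restrict_apply_le _ _).trans (hna2 x).le) bot_le⟩
  haveI : NullSingletonClass m := ⟨fun x =>
    le_antisymm ((Measure.restrict_apply_le _ _).trans (hna1 x).le) bot_le⟩
  set ρ := μJ.restrict (Ioi z ×ˢ Iio 0) with hρdef
  haveI : IsFiniteMeasure ρ := ⟨by
    rw [hρdef, Measure.restrict_apply_univ]
    exact lt_of_le_of_lt (measure_mono (by gcongr; exact subset_univ _)) (hf1 z hz)⟩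
  set G : ℝ → ℝ := fun b => -n.real (Iic b) with hGdef
  have hGc : Continuous G := by
    have : G = fun b => n.real (Ioi b) - n.real univ := by
      ext b
      have := measureReal_compl (μ := n) (measurableSet_Iic (a := b))
      rw [compl_Iic] at this
      rw [this]; simp [hGdef]
    rw [this]
    exact (q_tail_tendsto n).sub continuous_const
  have hGT : ∀ b < 0, G b = T₂ b := by
    intro b hb
    rw [hGdef, hT₂m b hb]
    simp only [hndef, measureReal_def]
    rw [Measure.restrict_apply measurableSet_Iic, inter_eq_left.2]
    intro y hy
    exact lt_of_le_of_lt hy hb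
  have hG0 : ∀ b, 0 ≤ b → G b = l₂ := by
    have h1 : ∀ b, 0 ≤ b → G b = G 0 := by
      intro b hb
      simp only [hGdef, hndef, measureReal_def]
      rw [Measure.restrict_apply measurableSet_Iic, Measure.restrict_apply measurableSet_Iic,
        inter_eq_right.2, inter_eq_right.2 Iio_subset_Iic_self]
      intro y hy
      exact le_trans (le_of_lt hy) hb
    have h2 : G 0 = l₂ := by
      refine tendsto_nhds_unique ((hGc.tendsto 0).mono_left nhdsWithin_le_nhds) (hl₂.congr' ?_)
      filter_upwards [self_mem_nhdsWithin] with b hb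
      exact (hGT b hb).symm
    intro b hb
    rw [h1 b hb, h2]
  have hRT : ∀ x, m.real (Ioi x) = T₁ (max x z) := by
    intro x
    rw [hT₁p _ (lt_max_of_lt_right hz), hmdef, measureReal_def,
      Measure.restrict_apply measurableSet_Ioi, Ioi_inter_Ioi]
  have hS0 : ∀ x > 0, (μJ (Ioi x ×ˢ Iio 0)).toReal = -C (T₁ x) l₂ := by
    intro x hx
    have t1 : Tendsto (fun b => C (T₁ x) (T₂ b)) (nhdsWithin 0 (Iio 0)) (nhds (C (T₁ x) l₂)) := by
      have : Continuous fun v => C (T₁ x) v :=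
        hC.continuous.comp (continuous_const.prodMk continuous_id)
      exact (this.tendsto _).comp hl₂
    haveI : IsFiniteMeasure (μJ.restrict (Ioi x ×ˢ univ)) :=
      ⟨by rw [Measure.restrict_apply_univ]; exact hf1 x hx⟩
    have t2 : Tendsto (fun b => (μJ.restrict (Ioi x ×ˢ univ)) (univ ×ˢ Iic b))
        (nhdsWithin 0 (Iio 0)) (nhds ((μJ.restrict (Ioi x ×ˢ univ)) (univ ×ˢ Iio 0))) := by
      apply tendsto_measure_of_ae_tendsto_indicator_of_isFiniteMeasure _
        (MeasurableSet.univ.prod measurableSet_Iio) (fun _ => MeasurableSet.univ.prod measurableSet_Iic)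
      refine Eventually.of_forall fun p => ?_
      by_cases hp : p.2 < 0
      · filter_upwards [mem_nhdsWithin_of_mem_nhds (lt_mem_nhds hp)] with b hb
        simp [hp, le_of_lt hb]
      · filter_upwards [self_mem_nhdsWithin] with b hb
        have hb' : b < 0 := hb
        simp only [mem_prod, mem_univ, mem_Iic, mem_Iio, true_and]
        constructor <;> intro <;> linarith
    have r : ∀ s : Set ℝ, MeasurableSet s →
        (μJ.restrict (Ioi x ×ˢ univ)) (univ ×ˢ s) = μJ (Ioi x ×ˢ s) := by
      intro s hs
      rw [Measure.restrict_apply (MeasurableSet.univ.prod hs), prod_inter_prod]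
      simp
    have t3 := ((ENNReal.tendsto_toReal (measure_ne_top _ _)).comp t2).neg
    have t4 : Tendsto (fun b => C (T₁ x) (T₂ b)) (nhdsWithin 0 (Iio 0))
        (nhds (-(μJ (Ioi x ×ˢ Iio 0)).toReal)) := by
      rw [r _ measurableSet_Iio] at t3
      refine t3.congr' ?_
      filter_upwards [self_mem_nhdsWithin] with b hb
      simp only [Function.comp]
      rw [r _ measurableSet_Iic, hS x hx b hb]
    have := tendsto_nhds_unique t1 t4
    linarith
  have key := q_core ρ m C hC G hGc (n.real univ) (fun b => by
      rw [hGdef, abs_neg, abs_of_nonneg measureReal_nonneg]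
      exact measureReal_mono (subset_univ _)) l₂ z z (by
      rw [hρdef, Measure.restrict_apply (measurableSet_Iic.prod MeasurableSet.univ), prod_inter_prod, hdisj]
      simp) (by
      rw [hmdef, Measure.restrict_apply measurableSet_Iic, hdisj]
      simp) (by
      intro x b
      rw [hRT]
      have hx' : 0 < max x z := lt_max_of_lt_right hz
      rw [hρdef, measureReal_def, Measure.restrict_apply (measurableSet_Ioi.prod measurableSet_Ioi),
        prod_inter_prod, Ioi_inter_Ioi]
      rcases lt_or_ge b 0 with hb | hb
      · have e : (Ioi (max x z) ×ˢ (Ioi b ∩ Iio 0) : Set (ℝ × ℝ))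
            = (Ioi (max x z) ×ˢ Iio 0) \ (Ioi (max x z) ×ˢ Iic b) := by
          ext p
          simp only [mem_prod, mem_inter_iff, mem_Ioi, mem_Iio, mem_diff, mem_Iic, not_and, not_le]
          tauto
        have hfi : ∀ s : Set ℝ, μJ (Ioi (max x z) ×ˢ s) ≠ ⊤ := fun s =>
          (lt_of_le_of_lt (measure_mono (by gcongr; exact subset_univ _)) (hf1 _ hx')).ne
        have h3 := measureReal_diff (μ := μJ) (s₁ := Ioi (max x z) ×ˢ Iio 0)
          (s₂ := Ioi (max x z) ×ˢ Iic b) (prod_mono_right fun y hy => lt_of_le_of_lt hy hb)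
          (measurableSet_Ioi.prod measurableSet_Iic) (hfi _)
        rw [← e] at h3
        simp only [measureReal_def] at h3
        rw [h3, hS0 _ hx', hGT b hb, ← hS _ hx' b hb]
        ring
      · have e : Ioi b ∩ Iio (0:ℝ) = ∅ := by
          ext y; simp only [mem_inter_iff, mem_Ioi, mem_Iio, mem_empty_iff_false, iff_false]
          rintro ⟨h1, h2⟩; linarith
        rw [e, hG0 b hb]; simp)
  have hset : {p : ℝ × ℝ | 0 < p.1 ∧ p.2 < 0 ∧ z < p.1 + p.2}
      = {p : ℝ × ℝ | z < p.1 + p.2} ∩ (Ioi z ×ˢ Iio 0) := by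
    ext p
    simp only [mem_setOf_eq, mem_inter_iff, mem_prod, mem_Ioi, mem_Iio]
    constructor
    · rintro ⟨h1, h2, h3⟩; exact ⟨h3, by linarith, h2⟩
    · rintro ⟨h1, h2, h3⟩; exact ⟨by linarith, h3, h1⟩
  have hms : MeasurableSet {p : ℝ × ℝ | z < p.1 + p.2} :=
    measurableSet_lt measurable_const (measurable_fst.add measurable_snd)
  rw [hset, ← Measure.restrict_apply hms]
  refine key.trans ?_
  refine setIntegral_congr_fun measurableSet_Ioi fun x hx => ?_
  have hx' : z < x := hx
  rw [hRT, max_eq_left hx'.le, hGT (z - x) (by linarith)]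

/-- Tail integrals of mixed-sign joint jumps under a Lévy copula:
for every `z > 0`,
`Π({(x,y) : x > 0, y < 0, x + y > z})
  = ∫_{(z,∞)} [∂Ĉ/∂u(Π̄₁ x, Π̄₂ (z - x)) - ∂Ĉ/∂u(Π̄₁ x, lim_{a↑0} Π̄₂ a)] Π₁(dx)` and
`Π({(x,y) : x < 0, y > 0, x + y > z})
  = ∫_{(z,∞)} [∂Ĉ/∂v(Π̄₁ (z - y), Π̄₂ y) - ∂Ĉ/∂v(lim_{a↑0} Π̄₁ a, Π̄₂ y)] Π₂(dy)`.
Here `μJ` plays the role of `Π`, `μ₁, μ₂` are its marginals, `T₁, T₂` the marginal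
tail integrals, `Tb` the quadrantwise joint tail integral and `Chat` the Lévy copula;
`l₁, l₂` are the limits `lim_{a↑0} Π̄ᵢ(a)`. -/
theorem quintuple_stmt12
    (μJ : Measure (ℝ × ℝ))
    -- bivariate Lévy measure
    (hfin : ∫⁻ p, ENNReal.ofReal (min 1 (‖p‖ ^ 2)) ∂μJ ≠ ⊤)
    (h0 : μJ {((0:ℝ), (0:ℝ))} = 0)
    -- marginal measures, assumed absolutely continuous
    (μ₁ μ₂ : Measure ℝ)
    (hμ₁ : ∀ A : Set ℝ, MeasurableSet A → μ₁ A = μJ ((A \ {0}) ×ˢ (univ : Set ℝ)))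
    (hμ₂ : ∀ A : Set ℝ, MeasurableSet A → μ₂ A = μJ ((univ : Set ℝ) ×ˢ (A \ {0})))
    (hac₁ : μ₁ ≪ (volume : Measure ℝ)) (hac₂ : μ₂ ≪ (volume : Measure ℝ))
    -- marginal tail integrals
    (T₁ T₂ : ℝ → ℝ)
    (hT₁p : ∀ x > (0:ℝ), T₁ x = (μ₁ (Ioi x)).toReal)
    (hT₁m : ∀ x < (0:ℝ), T₁ x = -(μ₁ (Iic x)).toReal)
    (hT₂p : ∀ x > (0:ℝ), T₂ x = (μ₂ (Ioi x)).toReal)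
    (hT₂m : ∀ x < (0:ℝ), T₂ x = -(μ₂ (Iic x)).toReal)
    -- quadrantwise joint tail integral
    (Tb : ℝ → ℝ → ℝ)
    (hTbpp : ∀ x₁ > (0:ℝ), ∀ x₂ > (0:ℝ), Tb x₁ x₂ = (μJ (Ioi x₁ ×ˢ Ioi x₂)).toReal)
    (hTbpm : ∀ x₁ > (0:ℝ), ∀ x₂ < (0:ℝ), Tb x₁ x₂ = -(μJ (Ioi x₁ ×ˢ Iic x₂)).toReal)
    (hTbmp : ∀ x₁ < (0:ℝ), ∀ x₂ > (0:ℝ), Tb x₁ x₂ = -(μJ (Iic x₁ ×ˢ Ioi x₂)).toReal)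
    (hTbmm : ∀ x₁ < (0:ℝ), ∀ x₂ < (0:ℝ), Tb x₁ x₂ = (μJ (Iic x₁ ×ˢ Iic x₂)).toReal)
    -- twice continuously differentiable Lévy copula and Sklar's theorem
    (Chat : ℝ → ℝ → ℝ) (hChat : ContDiff ℝ 2 (Function.uncurry Chat))
    (hSklar : ∀ x₁ x₂ : ℝ, x₁ ≠ 0 → x₂ ≠ 0 → Tb x₁ x₂ = Chat (T₁ x₁) (T₂ x₂))
    -- the limits `lim_{a↑0} Π̄ᵢ(a)` exist
    (l₁ l₂ : ℝ)
    (hl₁ : Tendsto T₁ (nhdsWithin 0 (Iio 0)) (nhds l₁))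
    (hl₂ : Tendsto T₂ (nhdsWithin 0 (Iio 0)) (nhds l₂)) :
    ∀ z > (0:ℝ),
      (μJ {p : ℝ × ℝ | 0 < p.1 ∧ p.2 < 0 ∧ z < p.1 + p.2}).toReal
        = ∫ x in Ioi z,
            (deriv (fun u => Chat u (T₂ (z - x))) (T₁ x)
              - deriv (fun u => Chat u l₂) (T₁ x)) ∂μ₁ ∧
      (μJ {p : ℝ × ℝ | p.1 < 0 ∧ 0 < p.2 ∧ z < p.1 + p.2}).toReal
        = ∫ y in Ioi z,
            (deriv (fun v => Chat (T₁ (z - y)) v) (T₂ y)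
              - deriv (fun v => Chat l₁ v) (T₂ y)) ∂μ₂ := by
  intro z hz
  refine ⟨q_half μJ hfin μ₁ μ₂ hμ₁ hμ₂ hac₁ hac₂ T₁ T₂ hT₁p hT₂m Chat hChat ?_ l₂ hl₂ z hz, ?_⟩
  · intro x hx y hy
    rw [← hSklar x y hx.ne' hy.ne, hTbpm x hx y hy]
  have hsw : ∀ s : Set (ℝ × ℝ), (μJ.map Prod.swap) s = μJ (Prod.swap ⁻¹' s) := fun s =>
    MeasurableEquiv.prodComm.map_apply s
  have h := q_half (μJ.map Prod.swap) (by
      rw [lintegral_map (by fun_prop) measurable_swap]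
      have : ∀ p : ℝ × ℝ, ‖p.swap‖ = ‖p‖ := fun p => by
        simp [Prod.norm_def, max_comm]
      simpa only [this] using hfin) μ₂ μ₁
    (fun A hA => by rw [hμ₂ A hA, hsw, preimage_swap_prod])
    (fun A hA => by rw [hμ₁ A hA, hsw, preimage_swap_prod])
    hac₂ hac₁ T₂ T₁ hT₂p hT₁m (fun u v => Chat v u)
    (hChat.comp (contDiff_snd.prodMk contDiff_fst))
    (fun x hx y hy => by
      rw [hsw, preimage_swap_prod, ← hSklar y x hy.ne hx.ne', hTbmp y hy x hx])
    l₁ hl₁ z hz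
  rw [← h, hsw]
  congr 2
  ext p
  simp only [mem_setOf_eq, mem_preimage, Prod.fst_swap, Prod.snd_swap, add_comm p.2 p.1]
  tauto
end

section
/- For a homogeneous Lévy copula that is left-continuous at ∞, the single-jump tail is negligible relative to the marginal tail: with Π̄_{P¹}(z) := Π̄₁(z) − lim_{y↓0} Ĉ(Π̄₁(z), Π̄₂(y)), one has lim_{z→∞} Π̄_{P¹}(z) / Π̄₁(z) = 0, i.e. Π̄_{P¹}(z) = o(Π̄₁(z)) as z → ∞. -/
open MeasureTheory Set Filter
open scoped ENNReal

/-- For a homogeneous Lévy copula that is left-continuous at `∞`, the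
single-jump tail is negligible relative to the marginal tail: with
`Π̄_{P¹}(z) := Π̄₁(z) - lim_{y↓0} Ĉ(Π̄₁ z, Π̄₂ y)` one has
`lim_{z→∞} Π̄_{P¹}(z)/Π̄₁(z) = 0`.  Here `Chat` is the Lévy copula, `T₁, T₂` the
nonincreasing marginal tails and `L z = lim_{y↓0} Ĉ(T₁ z, T₂ y)`. -/
theorem quintuple_stmt14
    (Chat : ℝ → ℝ → ℝ)
    (hcont : Continuous (Function.uncurry Chat))
    (hmono : ∀ u₁ u₂ v₁ v₂ : ℝ, 0 ≤ u₁ → 0 ≤ v₁ → u₁ ≤ u₂ → v₁ ≤ v₂ →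
      Chat u₁ v₁ ≤ Chat u₂ v₂)
    -- homogeneity of order 1
    (hhomog : ∀ c > (0:ℝ), ∀ u ≥ (0:ℝ), ∀ v ≥ (0:ℝ), Chat (c * u) (c * v) = c * Chat u v)
    -- left-continuity at `∞` with Lévy copula margin: `lim_{v→∞} Ĉ(1, v) = 1`
    (hmargin : Tendsto (fun v => Chat 1 v) atTop (nhds 1))
    -- marginal tails
    (T₁ T₂ : ℝ → ℝ)
    (hT₁pos : ∀ z > (0:ℝ), 0 < T₁ z) (hT₁anti : AntitoneOn T₁ (Ioi 0))
    (hT₁lim : Tendsto T₁ atTop (nhds 0))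
    (hT₂pos : ∀ y > (0:ℝ), 0 < T₂ y) (hT₂anti : AntitoneOn T₂ (Ioi 0))
    (l₂ : ℝ≥0∞) (hl₂ : 0 < l₂)
    (hT₂lim : Tendsto (fun y => ENNReal.ofReal (T₂ y)) (nhdsWithin 0 (Ioi 0)) (nhds l₂))
    -- the limit `L z = lim_{y↓0} Ĉ(T₁ z, T₂ y)` exists for each `z > 0`
    (L : ℝ → ℝ)
    (hL : ∀ z > (0:ℝ),
      Tendsto (fun y => Chat (T₁ z) (T₂ y)) (nhdsWithin 0 (Ioi 0)) (nhds (L z))) :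
    Tendsto (fun z => (T₁ z - L z) / T₁ z) atTop (nhds 0) := by
  have hle : ∀ v : ℝ, 0 ≤ v → Chat 1 v ≤ 1 := by
    intro v hv
    refine ge_of_tendsto hmargin ?_
    filter_upwards [eventually_ge_atTop v] with w hw
    exact hmono 1 1 v w zero_le_one hv le_rfl hw
  have hscale : ∀ z > (0:ℝ), ∀ y > (0:ℝ),
      Chat (T₁ z) (T₂ y) = T₁ z * Chat 1 (T₂ y / T₁ z) := by
    intro z hz y hy
    have h1 := hT₁pos z hz
    have h2 := hT₂pos y hy
    have h := hhomog (T₁ z) h1 1 zero_le_one (T₂ y / T₁ z) (div_pos h2 h1).le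
    rwa [mul_one, mul_div_cancel₀ _ h1.ne'] at h
  have hup : ∀ z > (0:ℝ), L z ≤ T₁ z := by
    intro z hz
    refine le_of_tendsto (hL z hz) ?_
    filter_upwards [self_mem_nhdsWithin] with y hy
    have hy0 : (0:ℝ) < y := hy
    rw [hscale z hz y hy0]
    exact mul_le_of_le_one_right (hT₁pos z hz).le
      (hle _ (div_pos (hT₂pos y hy0) (hT₁pos z hz)).le)
  have hlow : ∀ z > (0:ℝ), T₁ z * Chat 1 (T₂ 1 / T₁ z) ≤ L z := by
    intro z hz
    refine ge_of_tendsto (hL z hz) ?_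
    filter_upwards [Ioo_mem_nhdsGT (zero_lt_one' ℝ)] with y hy
    rw [← hscale z hz 1 one_pos]
    exact hmono _ _ _ _ (hT₁pos z hz).le (hT₂pos 1 one_pos).le le_rfl
      (hT₂anti hy.1 (mem_Ioi.2 one_pos) hy.2.le)
  have hT₁' : Tendsto T₁ atTop (nhdsWithin 0 (Ioi 0)) := by
    refine tendsto_nhdsWithin_iff.2 ⟨hT₁lim, ?_⟩
    filter_upwards [eventually_gt_atTop 0] with z hz
    exact hT₁pos z hz
  have hdiv : Tendsto (fun z => T₂ 1 / T₁ z) atTop atTop := by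
    simp only [div_eq_mul_inv]
    exact (tendsto_inv_nhdsGT_zero.comp hT₁').const_mul_atTop (hT₂pos 1 one_pos)
  have hlim : Tendsto (fun z => 1 - Chat 1 (T₂ 1 / T₁ z)) atTop (nhds 0) := by
    have h := (hmargin.comp hdiv).const_sub 1
    simpa using h
  refine tendsto_of_tendsto_of_tendsto_of_le_of_le' tendsto_const_nhds hlim ?_ ?_
  · filter_upwards [eventually_gt_atTop 0] with z hz
    exact div_nonneg (sub_nonneg.2 (hup z hz)) (hT₁pos z hz).le
  · filter_upwards [eventually_gt_atTop 0] with z hz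
    rw [div_le_iff₀ (hT₁pos z hz)]
    linarith [hlow z hz]
end

section
/- Jump intensity and jump size distribution of the sum of two dependent spectrally positive compound Poisson processes coupled by a Lévy copula: the total mass satisfies λ := Π( [0,∞)² ∖ {(0,0)} ) = λ₁ + λ₂ − Ĉ(λ₁, λ₂), and for every z > 0 the tail of the jump size d.f. F of the sum (with F̄(z) := (1/λ)·Π({(x,y) : x + y > z})) satisfies λ F̄(z) = λ₁ F̄₁(z) − Ĉ(λ₁ F̄₁(z), λ₂) + λ₂ F̄₂(z) − Ĉ(λ₁, λ₂ F̄₂(z)) + λ₁ ∫_{(0,∞)} ∂Ĉ/∂u ( λ₁ F̄₁(x), λ₂ F̄₂((z − x) ∨ 0) ) F₁(dx). -/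
open MeasureTheory Set Filter
open scoped ENNReal

lemma tail_antitone (μ : Measure ℝ) [IsFiniteMeasure μ] :
    Antitone (fun x => μ.real (Ioi x)) := fun _ _ h =>
  measureReal_mono (Ioi_subset_Ioi h)

lemma tail_continuous (μ : Measure ℝ) [IsFiniteMeasure μ] [NullSingletonClass μ] :
    Continuous (fun x => μ.real (Ioi x)) := by
  have h := intervalIntegral.continuous_primitive (μ := μ) (f := fun _ : ℝ => (1:ℝ))
    (fun a b => by constructor <;> exact integrableOn_const) 0
  have e : (fun x => μ.real (Ioi x)) = fun x => μ.real (Ioi 0) - ∫ _ in (0:ℝ)..x, (1:ℝ) ∂μ := by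
    funext x
    rw [intervalIntegral.integral_const', smul_eq_mul, mul_one]
    rcases le_total 0 x with hx | hx
    · rw [← Ioc_union_Ioi_eq_Ioi hx, measureReal_union (Ioc_disjoint_Ioi le_rfl) measurableSet_Ioi]
      simp [Ioc_eq_empty_of_le hx]
    · rw [← Ioc_union_Ioi_eq_Ioi hx, measureReal_union (Ioc_disjoint_Ioi le_rfl) measurableSet_Ioi]
      simp [Ioc_eq_empty_of_le hx]
      ring
  rw [e]
  exact continuous_const.sub h

lemma tail_tendsto (μ : Measure ℝ) [IsFiniteMeasure μ] :
    Tendsto (fun x => μ.real (Ioi x)) atTop (nhds 0) := by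
  have h := tendsto_measure_iInter_atTop (μ := μ) (s := fun x : ℝ => Ioi x)
    (fun _ => measurableSet_Ioi.nullMeasurableSet) (fun _ _ h => Ioi_subset_Ioi h)
    ⟨0, measure_ne_top _ _⟩
  have e : (⋂ x : ℝ, Ioi x) = ∅ := by
    ext y; simp only [mem_iInter, mem_Ioi, mem_empty_iff_false, iff_false]
    intro h; exact lt_irrefl _ (h y)
  rw [e, measure_empty] at h
  exact (ENNReal.tendsto_toReal ENNReal.zero_ne_top).comp h

lemma tail_map (μ : Measure ℝ) [IsFiniteMeasure μ] [NullSingletonClass μ] (a : ℝ) :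
    (μ.restrict (Ioi a)).map (fun x => μ.real (Ioi x)) =
      volume.restrict (Ioc 0 (μ.real (Ioi a))) := by
  have hc := tail_continuous μ
  have hanti := tail_antitone μ
  have huniv : (μ.restrict (Ioi a)).map (fun x => μ.real (Ioi x)) univ =
      volume.restrict (Ioc 0 (μ.real (Ioi a))) univ := by
    rw [Measure.map_apply hc.measurable MeasurableSet.univ]
    simp
  refine ext_of_generate_finite _ (borel_eq_generateFrom_Iio ℝ ▸ BorelSpace.measurable_eq)
    isPiSystem_Iio ?_ huniv
  rintro _ ⟨t, rfl⟩
  rw [Measure.map_apply hc.measurable measurableSet_Iio,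
    Measure.restrict_apply (hc.measurable measurableSet_Iio),
    Measure.restrict_apply measurableSet_Iio]
  rcases le_or_gt t 0 with ht | ht
  · have e1 : (fun x => μ.real (Ioi x)) ⁻¹' Iio t = ∅ := by
      ext x; simp only [mem_preimage, mem_Iio, mem_empty_iff_false, iff_false, not_lt]
      exact ht.trans measureReal_nonneg
    have e2 : Iio t ∩ Ioc 0 (μ.real (Ioi a)) = ∅ := by
      ext x; simp only [mem_inter_iff, mem_Iio, mem_Ioc, mem_empty_iff_false, iff_false]
      intro h; linarith [h.1, h.2.1]
    rw [e1, e2]; simp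
  by_cases hex : ∃ x, t ≤ μ.real (Ioi x)
  · -- the largest point with tail at least t
    set S := {x | t ≤ μ.real (Ioi x)} with hS
    have hclosed : IsClosed S := isClosed_le continuous_const hc
    obtain ⟨b, hb⟩ := ((tail_tendsto μ).eventually (gt_mem_nhds ht)).exists
    have hbdd : BddAbove S := ⟨b, fun x hx => by
      by_contra hlt
      exact absurd (hx.trans (hanti (not_le.1 hlt).le)) (not_le.2 hb)⟩
    set x0 := sSup S with hx0
    have hx0S : x0 ∈ S := hclosed.csSup_mem hex hbdd
    have hgt : ∀ x, x0 < x → μ.real (Ioi x) < t := fun x hx => by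
      by_contra hle
      exact absurd (le_csSup hbdd (not_lt.1 hle)) (not_le.2 hx)
    have hx0t : μ.real (Ioi x0) = t := by
      refine le_antisymm ?_ hx0S
      have : Tendsto (fun x => μ.real (Ioi x)) (nhdsWithin x0 (Ioi x0))
          (nhds (μ.real (Ioi x0))) := hc.continuousAt.tendsto.mono_left nhdsWithin_le_nhds
      refine le_of_tendsto this ?_
      filter_upwards [self_mem_nhdsWithin] with x hx using (hgt x hx).le
    have e1 : (fun x => μ.real (Ioi x)) ⁻¹' Iio t = Ioi x0 := by
      ext x; simp only [mem_preimage, mem_Iio, mem_Ioi]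
      refine ⟨fun h => ?_, hgt x⟩
      by_contra hle
      have := hanti (not_lt.1 hle)
      simp only at this
      linarith
    rw [e1, Ioi_inter_Ioi, ← ofReal_measureReal (μ := μ) (s := Ioi (x0 ⊔ a))]
    have e3 : μ.real (Ioi (x0 ⊔ a)) = min t (μ.real (Ioi a)) := by
      rw [← hx0t]; exact hanti.map_sup x0 a
    rw [e3]
    apply le_antisymm
    · calc _ = volume (Ioo 0 (min t (μ.real (Ioi a)))) := by simp
        _ ≤ volume (Iio t ∩ Ioc 0 (μ.real (Ioi a))) := measure_mono fun x hx => ⟨hx.2.trans_le (min_le_left _ _), hx.1,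
            (hx.2.trans_le (min_le_right _ _)).le⟩
    · calc _ ≤ volume (Ioc 0 (min t (μ.real (Ioi a)))) :=
            measure_mono fun x hx => ⟨hx.2.1, le_min (le_of_lt hx.1) hx.2.2⟩
        _ = _ := by simp
  · push Not at hex
    have e1 : (fun x => μ.real (Ioi x)) ⁻¹' Iio t = univ := by
      ext x; simp [hex x]
    have e2 : Iio t ∩ Ioc 0 (μ.real (Ioi a)) = Ioc 0 (μ.real (Ioi a)) :=
      inter_eq_right.2 fun x hx => hx.2.trans_lt (hex a)
    rw [e1, e2]; simp

lemma ae_eq_of_Ioi (μ : Measure ℝ) [IsFiniteMeasure μ] (f g : ℝ → ℝ)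
    (hf : Integrable f μ) (hg : Integrable g μ)
    (h : ∀ a, ∫ x in Ioi a, f x ∂μ = ∫ x in Ioi a, g x ∂μ) : f =ᵐ[μ] g := by
  have huniv : ∫ x, f x ∂μ = ∫ x, g x ∂μ := by
    have key : ∀ f : ℝ → ℝ, Integrable f μ →
        Tendsto (fun n : ℕ => ∫ x in Ioi (-(n:ℝ)), f x ∂μ) atTop (nhds (∫ x, f x ∂μ)) := by
      intro f hf
      have := tendsto_setIntegral_of_monotone (μ := μ) (f := f)
        (s := fun n : ℕ => Ioi (-(n:ℝ))) (fun _ => measurableSet_Ioi)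
        (fun m n hmn => Ioi_subset_Ioi (by simpa using hmn)) hf.integrableOn
      have e : (⋃ n : ℕ, Ioi (-(n:ℝ))) = univ := by
        ext x; simp only [mem_iUnion, mem_Ioi, mem_univ, iff_true]
        obtain ⟨n, hn⟩ := exists_nat_gt (-x)
        exact ⟨n, by linarith⟩
      rwa [e, setIntegral_univ] at this
    refine tendsto_nhds_unique (key f hf) ?_
    simp_rw [h]
    exact key g hg
  refine hf.ae_eq_of_forall_setIntegral_eq _ _ hg fun s hs _ => ?_
  induction s, hs using MeasurableSpace.induction_on_inter
    (borel_eq_generateFrom_Ioi ℝ ▸ BorelSpace.measurable_eq) isPiSystem_Ioi with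
  | empty => simp
  | basic t ht => obtain ⟨a, rfl⟩ := ht; exact h a
  | compl t htm ih =>
    have h1 := integral_add_compl htm hf
    have h2 := integral_add_compl htm hg
    have := ih (measure_lt_top _ _)
    linarith
  | iUnion F hd hm ih =>
    rw [integral_iUnion hm hd hf.integrableOn, integral_iUnion hm hd hg.integrableOn]
    exact tsum_congr fun i => ih i (measure_lt_top _ _)

lemma deriv_eq_fderiv (C : ℝ → ℝ → ℝ) (hC : ContDiff ℝ 2 (Function.uncurry C)) (u v : ℝ) :
    HasDerivAt (fun u => C u v) (fderiv ℝ (Function.uncurry C) (u, v) (1, 0)) u := by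
  have h1 : HasFDerivAt (Function.uncurry C) (fderiv ℝ (Function.uncurry C) (u, v)) (u, v) :=
    (hC.differentiable (by norm_num)).differentiableAt.hasFDerivAt
  have h2 : HasDerivAt (fun u : ℝ => (u, v)) ((1:ℝ), (0:ℝ)) u :=
    (hasDerivAt_id u).prodMk (hasDerivAt_const u v)
  exact h1.comp_hasDerivAt u h2

lemma core (ρ : Measure (ℝ × ℝ)) [IsFiniteMeasure ρ] [NullSingletonClass ρ.fst]
    (V : ℝ → ℝ) (hV : Continuous V)
    (C : ℝ → ℝ → ℝ) (hC : ContDiff ℝ 2 (Function.uncurry C)) (hC0 : ∀ v, C 0 v = 0)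
    (h : ∀ a, ∀ q, 0 ≤ q → ρ.real (Ioi a ×ˢ Ioi q) = C (ρ.fst.real (Ioi a)) (V q)) (z : ℝ) :
    ρ.real {p | (z - p.1) ⊔ 0 < p.2} =
      ∫ x, deriv (fun u => C u (V ((z - x) ⊔ 0))) (ρ.fst.real (Ioi x)) ∂ρ.fst := by
  set μ := ρ.fst with hμ
  set U : ℝ → ℝ := fun x => μ.real (Ioi x) with hU
  have hUc : Continuous U := tail_continuous μ
  set D : ℝ × ℝ → ℝ := fun p => fderiv ℝ (Function.uncurry C) p (1, 0) with hD
  have hDc : Continuous D := (hC.continuous_fderiv (by norm_num)).clm_apply continuous_const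
  have hder : ∀ u v, deriv (fun u => C u v) u = D (u, v) := fun u v =>
    (deriv_eq_fderiv C hC u v).deriv
  set κ := ρ.condKernel with hκ
  have hdis : μ.compProd κ = ρ := ρ.disintegrate κ
  have hfm : ∀ q, Measurable fun x => (κ x).real (Ioi q) := fun q =>
    (ProbabilityTheory.Kernel.measurable_coe κ measurableSet_Ioi).ennreal_toReal
  have hae : ∀ q : ℝ, 0 ≤ q → ∀ᵐ x ∂μ, (κ x).real (Ioi q) = D (U x, V q) := by
    intro q hq
    have hgc : Continuous fun u => D (u, V q) := by fun_prop
    have hgi : Integrable (fun x => D (U x, V q)) μ := by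
      obtain ⟨M, hM⟩ := (isCompact_Icc (a := (0:ℝ)) (b := μ.real univ)).exists_bound_of_continuousOn
        hgc.continuousOn
      refine Integrable.of_bound (hgc.comp hUc).aestronglyMeasurable M (ae_of_all _ fun x => ?_)
      exact hM _ ⟨measureReal_nonneg, measureReal_mono (subset_univ _)⟩
    have hfi : Integrable (fun x => (κ x).real (Ioi q)) μ := by
      refine Integrable.of_bound (hfm q).aestronglyMeasurable 1 (ae_of_all _ fun x => ?_)
      rw [Real.norm_of_nonneg measureReal_nonneg]
      exact measureReal_le_one
    refine ae_eq_of_Ioi μ _ _ hfi hgi fun a => ?_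
    have e1 : ∫ x in Ioi a, (κ x).real (Ioi q) ∂μ = C (U a) (V q) := by
      rw [← h a q hq]
      simp only [measureReal_def]
      rw [integral_toReal
        (ProbabilityTheory.Kernel.measurable_coe κ measurableSet_Ioi).aemeasurable
        (ae_of_all _ fun x => measure_lt_top _ _),
        ← Measure.compProd_apply_prod measurableSet_Ioi measurableSet_Ioi, hdis]
    have e2 : ∫ x in Ioi a, D (U x, V q) ∂μ = C (U a) (V q) := by
      have hm := tail_map μ a
      rw [← integral_map (φ := U) (f := fun u => D (u, V q)) hUc.aemeasurable
        hgc.aestronglyMeasurable, hm, ← intervalIntegral.integral_of_le measureReal_nonneg,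
        intervalIntegral.integral_eq_sub_of_hasDerivAt (f := fun u => C u (V q))
          (fun u _ => deriv_eq_fderiv C hC u (V q)) (hgc.intervalIntegrable _ _)]
      simp [hC0, hU]
    rw [e1, e2]
  have hall : ∀ᵐ x ∂μ, ∀ q : ℚ, 0 ≤ (q:ℝ) → (κ x).real (Ioi (q:ℝ)) = D (U x, V q) := by
    rw [ae_all_iff]; intro q
    by_cases hq : 0 ≤ (q:ℝ)
    · filter_upwards [hae q hq] with x hx _ using hx
    · exact ae_of_all _ fun x h => absurd h hq
  have hall' : ∀ᵐ x ∂μ, ∀ y : ℝ, 0 ≤ y → (κ x).real (Ioi y) = D (U x, V y) := by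
    filter_upwards [hall] with x hx y hy
    obtain ⟨u, hua, hul, hut⟩ := Real.exists_seq_rat_strictAnti_tendsto y
    have t1 : Tendsto (fun n => (κ x).real (Ioi (u n : ℝ))) atTop (nhds ((κ x).real (Ioi y))) := by
      have := tendsto_measure_iUnion_atTop (μ := κ x) (s := fun n => Ioi (u n : ℝ))
        (fun m n hmn => Ioi_subset_Ioi (by exact_mod_cast hua.antitone hmn))
      have e : (⋃ n, Ioi (u n : ℝ)) = Ioi y := by
        ext w; simp only [mem_iUnion, mem_Ioi]
        refine ⟨fun ⟨n, hn⟩ => (hul n).trans hn, fun hw => ?_⟩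
        exact (hut.eventually (gt_mem_nhds hw)).exists
      rw [e] at this
      exact (ENNReal.tendsto_toReal (measure_ne_top _ _)).comp this
    have t2 : Tendsto (fun n => D (U x, V (u n))) atTop (nhds (D (U x, V y))) :=
      ((hDc.comp (continuous_const.prodMk hV)).tendsto y).comp hut
    refine tendsto_nhds_unique t1 (t2.congr fun n => (hx (u n) (hy.trans (hul n).le)).symm)
  have hms : MeasurableSet {p : ℝ × ℝ | (z - p.1) ⊔ 0 < p.2} :=
    measurableSet_lt (by fun_prop) (by fun_prop)
  have e : ρ.real {p | (z - p.1) ⊔ 0 < p.2} = ∫ x, (κ x).real (Ioi ((z - x) ⊔ 0)) ∂μ := by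
    have hm := ProbabilityTheory.Kernel.measurable_kernel_prodMk_left (κ := κ) hms
    simp only [measureReal_def]
    rw [← hdis, Measure.compProd_apply hms, ← integral_toReal hm.aemeasurable
        (ae_of_all _ fun x => measure_lt_top _ _)]
    rfl
  rw [e]
  refine integral_congr_ae ?_
  filter_upwards [hall'] with x hx
  rw [hx _ le_sup_right, hder]

/-- Jump intensity and jump size distribution of the sum of two dependent
spectrally positive compound Poisson processes coupled by a Lévy copula:
`λ = Π([0,∞)² ∖ {(0,0)}) = λ₁ + λ₂ - Ĉ(λ₁, λ₂)` and for every `z > 0`,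
`λ F̄(z) = Π({(x,y) : x + y > z})
  = λ₁F̄₁(z) - Ĉ(λ₁F̄₁(z), λ₂) + λ₂F̄₂(z) - Ĉ(λ₁, λ₂F̄₂(z))
    + λ₁ ∫_{(0,∞)} ∂Ĉ/∂u(λ₁F̄₁(x), λ₂F̄₂((z-x) ∨ 0)) F₁(dx)`.
Here `μJ` plays the role of the finite bivariate Lévy measure `Π`, `μ₁, μ₂` its marginals,
`ν₁` the jump size distribution `F₁` of the first component and `Chat` the Lévy copula. -/
theorem quintuple_stmt15
    (μJ : Measure (ℝ × ℝ)) [IsFiniteMeasure μJ]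
    -- spectrally positive, no mass at the origin
    (hsupp : μJ {p : ℝ × ℝ | p.1 < 0 ∨ p.2 < 0} = 0)
    (h0 : μJ {((0:ℝ), (0:ℝ))} = 0)
    -- marginal measures, assumed absolutely continuous
    (μ₁ μ₂ : Measure ℝ)
    (hμ₁ : ∀ A : Set ℝ, MeasurableSet A → μ₁ A = μJ ((A \ {0}) ×ˢ (univ : Set ℝ)))
    (hμ₂ : ∀ A : Set ℝ, MeasurableSet A → μ₂ A = μJ ((univ : Set ℝ) ×ˢ (A \ {0})))
    (hac₁ : μ₁ ≪ (volume : Measure ℝ)) (hac₂ : μ₂ ≪ (volume : Measure ℝ))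
    -- the total masses (jump intensities)
    (lam₁ lam₂ : ℝ)
    (hlam₁ : lam₁ = (μ₁ (Ioi 0)).toReal) (hlam₁pos : 0 < lam₁)
    (hlam₂ : lam₂ = (μ₂ (Ioi 0)).toReal) (hlam₂pos : 0 < lam₂)
    -- the marginal jump size survival functions, `Π̄ᵢ(x) = λᵢ F̄ᵢ(x)` with `F̄ᵢ(0) = 1`
    (Fbar₁ Fbar₂ : ℝ → ℝ)
    (hFbar₁ : ∀ x > (0:ℝ), lam₁ * Fbar₁ x = (μ₁ (Ioi x)).toReal) (hFbar₁0 : Fbar₁ 0 = 1)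
    (hFbar₂ : ∀ x > (0:ℝ), lam₂ * Fbar₂ x = (μ₂ (Ioi x)).toReal) (hFbar₂0 : Fbar₂ 0 = 1)
    -- the jump size distribution of the first component: `Π₁ = λ₁ F₁`
    (ν₁ : Measure ℝ) [IsProbabilityMeasure ν₁]
    (hν₁ : ∀ A : Set ℝ, MeasurableSet A → μ₁ A = ENNReal.ofReal lam₁ * ν₁ A)
    -- twice continuously differentiable Lévy copula with grounding, and Sklar's theorem
    (Chat : ℝ → ℝ → ℝ) (hChat : ContDiff ℝ 2 (Function.uncurry Chat))
    (hChat0u : ∀ u : ℝ, Chat u 0 = 0) (hChat0v : ∀ v : ℝ, Chat 0 v = 0)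
    (hCcont : ContinuousOn (Function.uncurry Chat) (Icc 0 lam₁ ×ˢ Icc 0 lam₂))
    (hSklar : ∀ x₁ > (0:ℝ), ∀ x₂ > (0:ℝ),
      (μJ (Ioi x₁ ×ˢ Ioi x₂)).toReal = Chat (lam₁ * Fbar₁ x₁) (lam₂ * Fbar₂ x₂)) :
    (μJ ((univ : Set (ℝ × ℝ)) \ {((0:ℝ), (0:ℝ))})).toReal = lam₁ + lam₂ - Chat lam₁ lam₂ ∧
    ∀ z > (0:ℝ),
      (μJ {p : ℝ × ℝ | z < p.1 + p.2}).toReal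
        = lam₁ * Fbar₁ z - Chat (lam₁ * Fbar₁ z) lam₂
          + (lam₂ * Fbar₂ z - Chat lam₁ (lam₂ * Fbar₂ z))
          + lam₁ * ∫ x in Ioi (0:ℝ),
              deriv (fun u => Chat u (lam₂ * Fbar₂ ((z - x) ⊔ 0))) (lam₁ * Fbar₁ x) ∂ν₁ := by
  have hfin₁ : IsFiniteMeasure μ₁ := ⟨by rw [hμ₁ _ MeasurableSet.univ]; exact measure_lt_top _ _⟩
  have hfin₂ : IsFiniteMeasure μ₂ := ⟨by rw [hμ₂ _ MeasurableSet.univ]; exact measure_lt_top _ _⟩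
  have hna₁ : NullSingletonClass μ₁ := ⟨fun x => hac₁ (by simp)⟩
  have hna₂ : NullSingletonClass μ₂ := ⟨fun x => hac₂ (by simp)⟩
  set U : ℝ → ℝ := fun x => μ₁.real (Ioi x) with hU
  set V : ℝ → ℝ := fun x => μ₂.real (Ioi x) with hV
  have hUc : Continuous U := tail_continuous μ₁
  have hVc : Continuous V := tail_continuous μ₂
  have hU0 : lam₁ = U 0 := hlam₁
  have hV0 : lam₂ = V 0 := hlam₂
  have hFU : ∀ x, 0 ≤ x → lam₁ * Fbar₁ x = U x := by
    intro x hx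
    rcases hx.eq_or_lt with rfl | hx
    · rw [hFbar₁0, mul_one]; exact hlam₁
    · exact hFbar₁ x hx
  have hFV : ∀ x, 0 ≤ x → lam₂ * Fbar₂ x = V x := by
    intro x hx
    rcases hx.eq_or_lt with rfl | hx
    · rw [hFbar₂0, mul_one]; exact hlam₂
    · exact hFbar₂ x hx
  have hpos : ∀ᵐ p ∂μJ, 0 ≤ p.1 ∧ 0 ≤ p.2 := by
    rw [ae_iff]
    convert hsupp using 2
    ext p
    simp only [mem_ofPred_eq, not_and_or, not_le]
  -- Sklar up to the boundary
  have hS : ∀ a b : ℝ, 0 ≤ a → 0 ≤ b → μJ.real (Ioi a ×ˢ Ioi b) = Chat (U a) (V b) := by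
    intro a b ha hb
    have hut : ∀ c : ℝ, Tendsto (fun n : ℕ => c + 1 / ((n:ℝ) + 1)) atTop (nhds c) := fun c => by
      simpa using tendsto_one_div_add_atTop_nhds_zero_nat.const_add c
    have hanti : ∀ c : ℝ, ∀ m n : ℕ, m ≤ n → c + 1 / ((n:ℝ) + 1) ≤ c + 1 / ((m:ℝ) + 1) := by
      intro c m n hmn
      have : (m:ℝ) ≤ n := by exact_mod_cast hmn
      gcongr
    have hp : ∀ n : ℕ, 0 < 1 / ((n:ℝ) + 1) := fun n => by positivity
    have t1 := tendsto_measure_iUnion_atTop (μ := μJ)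
      (s := fun n : ℕ => Ioi (a + 1 / ((n:ℝ) + 1)) ×ˢ Ioi (b + 1 / ((n:ℝ) + 1)))
      (fun m n hmn => prod_mono (Ioi_subset_Ioi (hanti a m n hmn))
        (Ioi_subset_Ioi (hanti b m n hmn)))
    have e : (⋃ n : ℕ, Ioi (a + 1 / ((n:ℝ) + 1)) ×ˢ Ioi (b + 1 / ((n:ℝ) + 1))) =
        Ioi a ×ˢ Ioi b := by
      ext ⟨x, y⟩
      simp only [mem_iUnion, mem_prod, mem_Ioi]
      constructor
      · rintro ⟨n, h1, h2⟩
        have := hp n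
        constructor <;> linarith
      · rintro ⟨h1, h2⟩
        exact (((hut a).eventually (gt_mem_nhds h1)).and
          ((hut b).eventually (gt_mem_nhds h2))).exists
    rw [e] at t1
    have t1' := (ENNReal.tendsto_toReal (measure_ne_top μJ (Ioi a ×ˢ Ioi b))).comp t1
    have t2 : Tendsto (fun n : ℕ => Chat (U (a + 1 / ((n:ℝ) + 1))) (V (b + 1 / ((n:ℝ) + 1))))
        atTop (nhds (Chat (U a) (V b))) :=
      (hChat.continuous.tendsto (U a, V b)).comp
        (((hUc.tendsto a).comp (hut a)).prodMk_nhds ((hVc.tendsto b).comp (hut b)))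
    refine tendsto_nhds_unique t1' (t2.congr fun n => ?_)
    have h1 : 0 < a + 1 / ((n:ℝ) + 1) := by linarith [hp n]
    have h2 : 0 < b + 1 / ((n:ℝ) + 1) := by linarith [hp n]
    have := hSklar _ h1 _ h2
    rw [hFU _ h1.le, hFV _ h2.le] at this
    exact this.symm
  have hM1 : ∀ a : ℝ, 0 ≤ a → μJ.real (Ioi a ×ˢ univ) = U a := by
    intro a ha
    have : Ioi a \ {(0:ℝ)} = Ioi a := sdiff_singleton_eq_self (by simpa using ha)
    simp only [hU, measureReal_def, hμ₁ _ measurableSet_Ioi, this]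
  have hM2 : ∀ a : ℝ, 0 ≤ a → μJ.real (univ ×ˢ Ioi a) = V a := by
    intro a ha
    have : Ioi a \ {(0:ℝ)} = Ioi a := sdiff_singleton_eq_self (by simpa using ha)
    simp only [hV, measureReal_def, hμ₂ _ measurableSet_Ioi, this]
  have mI : ∀ a : ℝ, MeasurableSet (Ioi a) := fun a => measurableSet_Ioi
  constructor
  · have e1 : μJ.real (univ \ {((0:ℝ), (0:ℝ))}) =
        μJ.real ((Ioi 0 ×ˢ univ) ∪ (univ ×ˢ Ioi 0)) := by
      refine measureReal_congr (eventuallyEq_set.2 ?_)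
      filter_upwards [hpos] with p hp
      obtain ⟨x, y⟩ := p
      simp only [Set.mem_sdiff, mem_univ, true_and, mem_singleton_iff, Prod.mk.injEq, mem_union,
        mem_prod, mem_Ioi, and_true]
      simp only at hp
      constructor
      · intro h
        by_contra hcon
        push Not at hcon
        exact h ⟨le_antisymm hcon.1 hp.1, le_antisymm hcon.2 hp.2⟩
      · rintro (h | h) ⟨rfl, rfl⟩ <;> exact lt_irrefl _ h
    have e2 := measureReal_union_add_inter (μ := μJ) (s := Ioi (0:ℝ) ×ˢ (univ : Set ℝ))
      (t := (univ : Set ℝ) ×ˢ Ioi (0:ℝ)) (MeasurableSet.univ.prod (mI 0))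
    rw [prod_inter_prod, inter_univ, univ_inter, hS 0 0 le_rfl le_rfl, hM1 0 le_rfl,
      hM2 0 le_rfl] at e2
    change μJ.real _ = _
    rw [e1, hU0, hV0]
    linarith
  · intro z hz
    set ρ := μJ.restrict (Ioi 0 ×ˢ univ) with hρ
    have hfst : ρ.fst = μ₁ := by
      ext A hA
      rw [Measure.fst_apply hA, hρ, Measure.restrict_apply (measurable_fst hA), hμ₁ A hA]
      refine measure_congr (eventuallyEq_set.2 ?_)
      filter_upwards [hpos] with p hp
      simp only [mem_inter_iff, mem_preimage, mem_prod, mem_Ioi, mem_univ, and_true, Set.mem_sdiff,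
        mem_singleton_iff]
      exact and_congr_right fun _ => ⟨fun h => h.ne', fun h => lt_of_le_of_ne hp.1 (Ne.symm h)⟩
    have hUneg : ∀ a, U (a ⊔ 0) = U a := by
      intro a
      rcases le_total 0 a with ha | ha
      · rw [sup_eq_left.2 ha]
      · rw [sup_eq_right.2 ha]
        simp only [hU, measureReal_def, hμ₁ _ measurableSet_Ioi]
        congr 1
        refine measure_congr (eventuallyEq_set.2 ?_)
        filter_upwards [hpos] with p hp
        simp only [mem_prod, mem_Ioi, mem_univ, and_true, Set.mem_sdiff, mem_singleton_iff]
        exact ⟨fun h => ⟨ha.trans_lt h.1, h.2⟩,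
          fun h => ⟨lt_of_le_of_ne hp.1 (Ne.symm h.2), h.2⟩⟩
    have hna : NullSingletonClass ρ.fst := by rw [hfst]; exact hna₁
    have hcore := core ρ V hVc Chat hChat hChat0v (by
      intro a q hq
      rw [hfst]
      change _ = Chat (U a) (V q)
      rw [← hUneg a, ← hS _ _ le_sup_right hq, measureReal_def, hρ,
        Measure.restrict_apply ((mI a).prod (mI q)), prod_inter_prod, Ioi_inter_Ioi, inter_univ,
        measureReal_def]) z
    rw [hfst] at hcore
    -- rewrite the integral
    have hμν : μ₁ = ENNReal.ofReal lam₁ • ν₁ := by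
      ext A hA
      rw [hν₁ A hA]; rfl
    have hIic : ∀ᵐ x ∂ν₁, x ∈ Ioi (0:ℝ) := by
      have h1 : μ₁ (Iic 0) = 0 := by
        rw [hμ₁ _ measurableSet_Iic]
        refine measure_mono_null ?_ hsupp
        rintro p ⟨⟨h1, h2⟩, -⟩
        exact Or.inl (lt_of_le_of_ne h1 h2)
      rw [hν₁ _ measurableSet_Iic] at h1
      have h2 : ν₁ (Iic 0) = 0 := by
        rcases mul_eq_zero.1 h1 with h | h
        · exact absurd hlam₁pos (not_lt.2 (ENNReal.ofReal_eq_zero.1 h))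
        · exact h
      rw [ae_iff]
      convert h2 using 2
      ext x; simp
    have hint : ∫ x, deriv (fun u => Chat u (V ((z - x) ⊔ 0))) (μ₁.real (Ioi x)) ∂μ₁ =
        lam₁ * ∫ x in Ioi (0:ℝ),
          deriv (fun u => Chat u (lam₂ * Fbar₂ ((z - x) ⊔ 0))) (lam₁ * Fbar₁ x) ∂ν₁ := by
      have e1 : ∀ f : ℝ → ℝ, ∫ x, f x ∂μ₁ = lam₁ * ∫ x, f x ∂ν₁ := by
        intro f
        rw [hμν, integral_smul_measure, ENNReal.toReal_ofReal hlam₁pos.le, smul_eq_mul]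
      rw [e1, Measure.restrict_eq_self_of_ae_mem hIic]
      congr 1
      refine integral_congr_ae ?_
      filter_upwards [hIic] with x hx
      rw [hFU x (le_of_lt hx), hFV _ le_sup_right]
    rw [← hint, ← hcore, hFU z hz.le, hFV z hz.le, hU0, hV0, ← hS z 0 hz.le le_rfl,
      ← hS 0 z le_rfl hz.le, ← hM1 z hz.le, ← hM2 z hz.le]
    change μJ.real _ = _
    have mC : MeasurableSet {p : ℝ × ℝ | (z - p.1) ⊔ 0 < p.2} :=
      measurableSet_lt (by fun_prop) (by fun_prop)
    have e3 : ρ.real {p | (z - p.1) ⊔ 0 < p.2} =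
        μJ.real ({p | (z - p.1) ⊔ 0 < p.2} ∩ (Ioi 0 ×ˢ univ)) := by
      rw [measureReal_def, hρ, Measure.restrict_apply mC, measureReal_def]
    have d1 : μJ.real (Ioi z ×ˢ univ) - μJ.real (Ioi z ×ˢ Ioi 0) = μJ.real (Ioi z ×ˢ Iic 0) := by
      have : Ioi z ×ˢ (univ : Set ℝ) = (Ioi z ×ˢ Iic 0) ∪ (Ioi z ×ˢ Ioi 0) := by
        rw [← prod_union, Iic_union_Ioi]
      rw [this, measureReal_union _ ((mI z).prod (mI 0))]
      · ring
      · exact Disjoint.set_prod_right (Iic_disjoint_Ioi le_rfl) _ _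
    have d2 : μJ.real (univ ×ˢ Ioi z) - μJ.real (Ioi 0 ×ˢ Ioi z) = μJ.real (Iic 0 ×ˢ Ioi z) := by
      have : (univ : Set ℝ) ×ˢ Ioi z = (Iic 0 ×ˢ Ioi z) ∪ (Ioi 0 ×ˢ Ioi z) := by
        rw [← union_prod, Iic_union_Ioi]
      rw [this, measureReal_union _ ((mI 0).prod (mI z))]
      · ring
      · exact Disjoint.set_prod_left (Iic_disjoint_Ioi le_rfl) _ _
    rw [d1, d2, e3, ← measureReal_union _ (measurableSet_Iic.prod (mI z)),
      ← measureReal_union _ (mC.inter ((mI 0).prod MeasurableSet.univ))]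
    · refine measureReal_congr (eventuallyEq_set.2 ?_)
      filter_upwards [hpos] with p hp
      obtain ⟨x, y⟩ := p
      simp only [mem_ofPred_eq, mem_union, mem_prod, mem_Ioi, mem_Iic, mem_inter_iff, mem_univ,
        and_true, sup_lt_iff]
      simp only at hp
      obtain ⟨hx, hy⟩ := hp
      constructor
      · intro h
        rcases hx.eq_or_lt with rfl | hx
        · exact Or.inl (Or.inr ⟨le_rfl, by linarith⟩)
        rcases hy.eq_or_lt with rfl | hy
        · exact Or.inl (Or.inl ⟨by linarith, le_rfl⟩)
        exact Or.inr ⟨⟨by linarith, hy⟩, hx⟩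
      · rintro ((h | h) | h)
        · linarith [h.1]
        · linarith [h.2]
        · linarith [h.1.1]
    · rw [Set.disjoint_left]
      rintro ⟨x, y⟩ h h'
      simp only [mem_ofPred_eq, mem_union, mem_prod, mem_Ioi, mem_Iic, mem_inter_iff, mem_univ,
        and_true, sup_lt_iff] at h h'
      rcases h with h | h
      · linarith [h.2, h'.1.2]
      · linarith [h.1, h'.2]
    · rw [Set.disjoint_left]
      rintro ⟨x, y⟩ h h'
      simp only [mem_prod, mem_Ioi, mem_Iic] at h h'
      linarith [h.1, h'.1]
end

section
/- Asymptotics for the nonhomogeneous Archimedean Lévy copula with exponential margins: for a > 0 and ζ > 0, define Π̄_S(z) := 2 [ e^{−a z} − Ĉ_ζ(e^{−a z}, 1) ] + ∫₀^∞ (∂Ĉ_ζ/∂u)( e^{−a x}, e^{−a ((z−x) ∨ 0)} ) · a e^{−a x} dx for z > 0, where Ĉ_ζ(u, v) = u v / (u + v + ζ) and (∂Ĉ_ζ/∂u)(u, v) = (v² + ζ v)/(u + v + ζ)². Then lim_{z→∞} ( ζ e^{a z} / (a z) ) · Π̄_S(z) = 1, i.e. Π̄_S(z) ∼ (a/ζ)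 z e^{−a z} as z → ∞; in particular the common jumps dominate asymptotically. Moreover each single-jump tail satisfies e^{−a z} − Ĉ_ζ(e^{−a z}, 1) ∼ (ζ/(1+ζ)) e^{−a z} as z → ∞. -/
open MeasureTheory Set Filter

/-- The rescaled common-jump integrand. -/
noncomputable def GG (a ζ z t : ℝ) : ℝ :=
  ζ * Real.exp (a * z) * (((Real.exp (-a * ((z - z * t) ⊔ 0))) ^ 2
      + ζ * Real.exp (-a * ((z - z * t) ⊔ 0)))
    / (Real.exp (-a * (z * t)) + Real.exp (-a * ((z - z * t) ⊔ 0)) + ζ) ^ 2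
    * Real.exp (-a * (z * t)))

lemma GG_nonneg (a ζ z t : ℝ) (hζ : 0 < ζ) : 0 ≤ GG a ζ z t := by
  unfold GG; positivity

lemma GG_lt (a ζ z t : ℝ) (hz : 0 < z) (ht : t ≤ 1) :
    GG a ζ z t = ζ * (Real.exp (-a * (z - z * t)) + ζ)
      / (Real.exp (-a * (z * t)) + Real.exp (-a * (z - z * t)) + ζ) ^ 2 := by
  unfold GG
  have h : (z - z * t) ⊔ 0 = z - z * t := max_eq_left (by nlinarith)
  rw [h]
  have e : Real.exp (a * z) * Real.exp (-a * (z - z * t)) * Real.exp (-a * (z * t)) = 1 := by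
    rw [← Real.exp_add, ← Real.exp_add, Real.exp_eq_one_iff]; ring
  generalize Real.exp (-a * (z - z * t)) = v at *
  generalize Real.exp (-a * (z * t)) = u at *
  generalize Real.exp (a * z) = w at *
  have : ζ * w * ((v ^ 2 + ζ * v) / (u + v + ζ) ^ 2 * u)
      = (w * v * u) * (ζ * (v + ζ) / (u + v + ζ) ^ 2) := by ring
  rw [this, e, one_mul]

lemma aux_frac (ζ u v : ℝ) (hζ : 0 < ζ) (hu : 0 < u) (hv : 0 < v) :
    ζ * (v + ζ) / (u + v + ζ) ^ 2 ≤ 1 := by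
  rw [div_le_one (by positivity)]
  nlinarith [mul_pos hu hv, mul_pos hu hζ, mul_pos hv hζ, sq_nonneg u, sq_nonneg v]

lemma GG_ge (a ζ z t : ℝ) (hζ : 0 < ζ) (hz : 0 < z) (ht : 1 ≤ t) :
    GG a ζ z t ≤ Real.exp (-(a * (t - 1)) * z) := by
  unfold GG
  have h : (z - z * t) ⊔ 0 = 0 := max_eq_right (by nlinarith)
  rw [h]
  have e : Real.exp (-(a * (t - 1)) * z) = Real.exp (a * z) * Real.exp (-a * (z * t)) := by
    rw [← Real.exp_add]; ring_nf
  rw [e]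
  have hu := Real.exp_pos (-a * (z * t))
  have hw := Real.exp_pos (a * z)
  simp only [mul_zero, Real.exp_zero]
  generalize Real.exp (-a * (z * t)) = u at *
  generalize Real.exp (a * z) = w at *
  have := aux_frac ζ u 1 hζ hu one_pos
  have e2 : ζ * w * ((1 ^ 2 + ζ * 1) / (u + 1 + ζ) ^ 2 * u)
      = (w * u) * (ζ * (1 + ζ) / (u + 1 + ζ) ^ 2) := by ring
  rw [e2]
  exact mul_le_of_le_one_right (by positivity) this

lemma GG_bound (a ζ z t : ℝ) (ha : 0 < a) (hζ : 0 < ζ) (hz : 1 ≤ z) :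
    GG a ζ z t ≤ Real.exp a * Real.exp (-a * t) := by
  rw [← Real.exp_add]
  rcases le_total t 1 with ht | ht
  · rw [GG_lt a ζ z t (by linarith) ht]
    refine (aux_frac ζ _ _ hζ (Real.exp_pos _) (Real.exp_pos _)).trans ?_
    exact Real.one_le_exp (by nlinarith)
  · refine (GG_ge a ζ z t hζ (by linarith) ht).trans (Real.exp_le_exp.2 ?_)
    have : 0 ≤ a * (t - 1) := mul_nonneg ha.le (by linarith)
    nlinarith

lemma exp_lim (c : ℝ) (hc : 0 < c) : Tendsto (fun z : ℝ => Real.exp (-c * z)) atTop (nhds 0) :=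
  Real.tendsto_exp_atBot.comp (tendsto_id.const_mul_atTop_of_neg (by linarith))

lemma GG_lim (a ζ t : ℝ) (ha : 0 < a) (hζ : 0 < ζ) (ht0 : 0 < t) (ht1 : t ≠ 1) :
    Tendsto (fun z => GG a ζ z t) atTop (nhds ((Iio (1:ℝ)).indicator (fun _ => (1:ℝ)) t)) := by
  rcases lt_or_gt_of_ne ht1 with ht | ht
  · rw [indicator_of_mem (mem_Iio.2 ht)]
    have hu : Tendsto (fun z : ℝ => Real.exp (-a * (z * t))) atTop (nhds 0) := by
      refine (exp_lim (a * t) (by positivity)).congr fun z => ?_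
      ring_nf
    have hv : Tendsto (fun z : ℝ => Real.exp (-a * (z - z * t))) atTop (nhds 0) := by
      refine (exp_lim (a * (1 - t)) (mul_pos ha (by linarith))).congr fun z => ?_
      ring_nf
    have h : Tendsto (fun z : ℝ => ζ * (Real.exp (-a * (z - z * t)) + ζ)
      / (Real.exp (-a * (z * t)) + Real.exp (-a * (z - z * t)) + ζ) ^ 2) atTop
      (nhds (ζ * (0 + ζ) / (0 + 0 + ζ) ^ 2)) :=
      ((hv.add_const ζ).const_mul ζ).div (((hu.add hv).add_const ζ).pow 2) (by simp [hζ.ne'])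
    have e : ζ * (0 + ζ) / (0 + 0 + ζ) ^ 2 = 1 := by simp only [zero_add]; field_simp
    rw [e] at h
    refine h.congr' ?_
    filter_upwards [eventually_gt_atTop 0] with z hz
    exact (GG_lt a ζ z t hz ht.le).symm
  · rw [indicator_of_notMem (by simpa using ht.le)]
    refine tendsto_of_tendsto_of_tendsto_of_le_of_le' tendsto_const_nhds
      (exp_lim (a * (t - 1)) (mul_pos ha (by linarith))) ?_ ?_
    · exact Eventually.of_forall fun z => GG_nonneg a ζ z t hζ
    · filter_upwards [eventually_gt_atTop 0] with z hz
      exact GG_ge a ζ z t hζ hz ht.le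

lemma GG_int (a ζ : ℝ) (ha : 0 < a) (hζ : 0 < ζ) :
    Tendsto (fun z => ∫ t in Ioi (0:ℝ), GG a ζ z t) atTop (nhds 1) := by
  have e : ∫ t in Ioi (0:ℝ), (Iio (1:ℝ)).indicator (fun _ => (1:ℝ)) t = 1 := by
    rw [setIntegral_indicator measurableSet_Iio, Ioi_inter_Iio]
    simp
  rw [← e]
  refine tendsto_integral_filter_of_dominated_convergence
    (fun t => Real.exp a * Real.exp (-a * t)) ?_ ?_ ?_ ?_
  · refine Eventually.of_forall fun z => Measurable.aestronglyMeasurable ?_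
    unfold GG
    fun_prop
  · filter_upwards [eventually_ge_atTop 1] with z hz
    refine Eventually.of_forall fun t => ?_
    rw [Real.norm_of_nonneg (GG_nonneg a ζ z t hζ)]
    exact GG_bound a ζ z t ha hζ hz
  · exact (exp_neg_integrableOn_Ioi 0 ha).const_mul _
  · have h1 : ∀ᵐ t ∂(volume.restrict (Ioi (0:ℝ))), t ≠ 1 :=
      ae_restrict_of_ae (Measure.ae_ne volume 1)
    filter_upwards [ae_restrict_mem measurableSet_Ioi, h1] with t h0 h1
    exact GG_lim a ζ t ha hζ h0 h1

/-- Asymptotics for the nonhomogeneous Archimedean Lévy copula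
`Ĉ_ζ(u,v) = uv/(u+v+ζ)` with exponential margins `Π̄_{S¹}(x) = Π̄_{S²}(x) = e^{-ax}`:
with `Π̄_S(z) = 2[e^{-az} - Ĉ_ζ(e^{-az},1)] + ∫₀^∞ (∂Ĉ_ζ/∂u)(e^{-ax}, e^{-a((z-x)∨0)}) a e^{-ax} dx`
one has `Π̄_S(z) ∼ (a/ζ) z e^{-az}` as `z → ∞` (the common jumps dominate), and each
single-jump tail satisfies `e^{-az} - Ĉ_ζ(e^{-az},1) ∼ (ζ/(1+ζ)) e^{-az}`. -/
theorem quintuple_stmt16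
    (a ζ : ℝ) (ha : 0 < a) (hζ : 0 < ζ)
    (Chat : ℝ → ℝ → ℝ)
    (hChat : ∀ u v : ℝ, Chat u v = u * v / (u + v + ζ))
    (PiS : ℝ → ℝ)
    (hPiS : ∀ z > (0:ℝ), PiS z =
      2 * (Real.exp (-a * z) - Chat (Real.exp (-a * z)) 1)
        + ∫ x in Ioi (0:ℝ),
            ((Real.exp (-a * ((z - x) ⊔ 0))) ^ 2 + ζ * Real.exp (-a * ((z - x) ⊔ 0)))
              / (Real.exp (-a * x) + Real.exp (-a * ((z - x) ⊔ 0)) + ζ) ^ 2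
              * (a * Real.exp (-a * x))) :
    Tendsto (fun z => ζ * Real.exp (a * z) / (a * z) * PiS z) atTop (nhds 1) ∧
    Tendsto (fun z =>
        (Real.exp (-a * z) - Chat (Real.exp (-a * z)) 1)
          / (ζ / (1 + ζ) * Real.exp (-a * z))) atTop (nhds 1) := by
  have hw := exp_lim a ha
  have key : ∀ z, Real.exp (-a * z) - Chat (Real.exp (-a * z)) 1
      = Real.exp (-a * z) * (1 - 1 / (Real.exp (-a * z) + 1 + ζ)) := by
    intro z; rw [hChat]; ring
  have hl : Tendsto (fun z : ℝ => 1 - 1 / (Real.exp (-a * z) + 1 + ζ)) atTop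
      (nhds (1 - 1 / (0 + 1 + ζ))) :=
    tendsto_const_nhds.sub (tendsto_const_nhds.div ((hw.add_const 1).add_const ζ) (by positivity))
  constructor
  · have hinv : Tendsto (fun z : ℝ => (2 * ζ / a) * z⁻¹) atTop (nhds ((2 * ζ / a) * 0)) :=
      tendsto_inv_atTop_zero.const_mul _
    have h := (hinv.mul hl).add (GG_int a ζ ha hζ)
    simp only [mul_zero, zero_mul, zero_add] at h
    refine h.congr' ?_
    filter_upwards [eventually_gt_atTop 0] with z hz
    rw [hPiS z hz, key, mul_add]
    have ew : Real.exp (a * z) * Real.exp (-a * z) = 1 := by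
      rw [← Real.exp_add, Real.exp_eq_one_iff]; ring
    congr 1
    · generalize 1 - 1 / (Real.exp (-a * z) + 1 + ζ) = q
      have : ζ * Real.exp (a * z) / (a * z) * (2 * (Real.exp (-a * z) * q))
        = (Real.exp (a * z) * Real.exp (-a * z)) * (2 * ζ / a * z⁻¹ * q) := by
        field_simp
      rw [this, ew, one_mul]
    · have hc := integral_comp_mul_left_Ioi (fun x =>
            ((Real.exp (-a * ((z - x) ⊔ 0))) ^ 2 + ζ * Real.exp (-a * ((z - x) ⊔ 0)))
              / (Real.exp (-a * x) + Real.exp (-a * ((z - x) ⊔ 0)) + ζ) ^ 2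
              * (a * Real.exp (-a * x))) 0 hz
      rw [mul_zero, smul_eq_mul] at hc
      have : ∀ I : ℝ, ζ * Real.exp (a * z) / (a * z) * I
          = ζ * Real.exp (a * z) / a * (z⁻¹ * I) := by intro I; field_simp
      rw [this, ← hc, ← integral_const_mul]
      congr 1
      funext t
      unfold GG
      field_simp
  · have h := hl.div_const (ζ / (1 + ζ))
    have e : (1 - 1 / (0 + 1 + ζ)) / (ζ / (1 + ζ)) = 1 := by
      have : 1 + ζ ≠ 0 := by positivity
      rw [zero_add]; field_simp; ring
    rw [e] at h
    refine h.congr fun z => ?_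
    rw [key]
    have := Real.exp_pos (-a * z)
    generalize 1 - 1 / (Real.exp (-a * z) + 1 + ζ) = q
    field_simp
end

section
/- Survival-copula form of the jump size tail for the sum of two always-jointly-jumping random walks with positive increments: for every z > 0, P(ξ¹ + ξ² > z) = ∫_{(0,∞)} ∂C̃/∂u ( F̄₁(x), F̄₂((z − x) ∨ 0) ) F₁(dx), where C̃(u, v) = u + v − 1 + C(1 − u, 1 − v) is the survival copula of C, F̄ᵢ = 1 − Fᵢ, and ∂C̃/∂u denotes the partial derivative of C̃ in its first argument. -/
open MeasureTheory Set Filter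

open ProbabilityTheory Topology in
lemma aux_cdf_cont (μ : Measure ℝ) [IsProbabilityMeasure μ] (h : μ ≪ volume) :
    Continuous (fun a => μ.real (Iic a)) := by
  have e : (fun a => μ.real (Iic a)) = cdf μ := by
    funext a; rw [cdf_eq_real]
  rw [e, continuous_iff_continuousAt]
  intro a
  rw [(monotone_cdf μ).continuousAt_iff_leftLim_eq_rightLim, StieltjesFunction.rightLim_eq]
  have h0 : μ {a} = 0 := h (by simp)
  rw [← measure_cdf μ, StieltjesFunction.measure_singleton, ENNReal.ofReal_eq_zero] at h0
  have := (monotone_cdf μ).leftLim_le (le_refl a)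
  linarith

lemma aux_map (μ : Measure ℝ) [IsProbabilityMeasure μ] (h : μ ≪ volume)
    (h0 : μ (Iic 0) = 0) (a : ℝ) :
    (μ.restrict (Iic a)).map (fun x => μ.real (Iic x))
      = volume.restrict (Ioc 0 (μ.real (Iic a))) := by
  have hc := aux_cdf_cont μ h
  have hm : Monotone (fun x => μ.real (Iic x)) := fun x y hxy =>
    measureReal_mono (Iic_subset_Iic.2 hxy)
  refine Measure.ext_of_Iic _ _ fun t => ?_
  rw [Measure.map_apply hc.measurable measurableSet_Iic,
    Measure.restrict_apply (hc.measurable measurableSet_Iic),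
    Measure.restrict_apply measurableSet_Iic]
  rw [Set.inter_comm (Iic t), Ioc_inter_Iic, Real.volume_Ioc, sub_zero]
  rcases le_or_gt (μ.real (Iic a)) t with hta | hta
  · rw [inf_eq_left.2 hta, ofReal_measureReal]
    congr 1
    ext x
    simp only [mem_inter_iff, mem_preimage, mem_Iic]
    exact ⟨fun h => h.2, fun h => ⟨(hm h).trans hta, h⟩⟩
  rw [inf_eq_right.2 hta.le]
  rcases lt_or_ge t 0 with ht | ht
  · rw [ENNReal.ofReal_of_nonpos ht.le]
    convert measure_empty (μ := μ)
    ext x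
    simp only [mem_inter_iff, mem_preimage, mem_Iic, mem_empty_iff_false, iff_false]
    intro hx
    have : 0 ≤ μ.real (Iic x) := measureReal_nonneg
    linarith [hx.1]
  have h0r : μ.real (Iic 0) = 0 := by simp [measureReal_def, h0]
  have ha : 0 ≤ a := by
    by_contra hcon
    have := hm (le_of_not_ge hcon)
    simp only at this
    linarith
  have hcomp : IsCompact (Icc 0 a ∩ (fun x => μ.real (Iic x)) ⁻¹' {t}) :=
    isCompact_Icc.inter_right (isClosed_singleton.preimage hc)
  have hne : (Icc 0 a ∩ (fun x => μ.real (Iic x)) ⁻¹' {t}).Nonempty := by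
    obtain ⟨c, hc1, hc2⟩ := intermediate_value_Icc ha hc.continuousOn
      (show t ∈ Icc (μ.real (Iic 0)) (μ.real (Iic a)) from ⟨by linarith, hta.le⟩)
    exact ⟨c, hc1, hc2⟩
  obtain ⟨c, hc1, hc2⟩ := hcomp.exists_isGreatest hne
  have hct : μ.real (Iic c) = t := hc1.2
  rw [← hct, ofReal_measureReal]
  congr 1
  ext x
  simp only [mem_inter_iff, mem_preimage, mem_Iic]
  constructor
  · rintro ⟨h1, h2⟩
    by_contra hcon
    have hcon := le_of_not_ge hcon
    have : x ∈ Icc 0 a ∩ (fun x => μ.real (Iic x)) ⁻¹' {t} :=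
      ⟨⟨hc1.1.1.trans hcon, h2⟩, (h1.trans hct.le).antisymm (hct.symm.le.trans (hm hcon))⟩
    have := hc2 this
    grind
  · intro hx
    exact ⟨hm hx, hx.trans hc1.1.2⟩

open Topology in
lemma aux_ae (μ : Measure ℝ) [IsProbabilityMeasure μ] (f g : ℝ → ℝ) (hf : Integrable f μ)
    (hg : Integrable g μ) (h : ∀ a, ∫ x in Iic a, f x ∂μ = ∫ x in Iic a, g x ∂μ) :
    f =ᵐ[μ] g := by
  have htot : ∫ x, f x ∂μ = ∫ x, g x ∂μ := by
    have h1 := (aecover_Iic (μ := μ) (tendsto_id (α := ℝ) (x := atTop))).integral_tendsto_of_countably_generated hf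
    have h2 := (aecover_Iic (μ := μ) (tendsto_id (α := ℝ) (x := atTop))).integral_tendsto_of_countably_generated hg
    simp only [id, h] at h1 h2
    exact tendsto_nhds_unique h1 h2
  refine hf.ae_eq_of_forall_setIntegral_eq _ _ hg fun s hs _ => ?_
  refine MeasurableSpace.induction_on_inter
    (C := fun s _ => ∫ x in s, f x ∂μ = ∫ x in s, g x ∂μ)
    (BorelSpace.measurable_eq.trans (borel_eq_generateFrom_Iic ℝ)) isPiSystem_Iic ?_ ?_ ?_ ?_ s hs
  · simp
  · rintro _ ⟨a, rfl⟩
    exact h a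
  · intro t ht he
    rw [setIntegral_compl ht hf, setIntegral_compl ht hg, htot, he]
  · intro F hd hF he
    rw [integral_iUnion hF hd hf.integrableOn, integral_iUnion hF hd hg.integrableOn]
    simp only [he]

/-- Survival-copula form of the jump size tail for the sum of two
always-jointly-jumping random walks with strictly positive increments: for every `z > 0`,
`P(ξ¹ + ξ² > z) = ∫_{(0,∞)} ∂C̃/∂u(F̄₁ x, F̄₂ ((z - x) ∨ 0)) F₁(dx)`,
where `C̃(u,v) = u + v - 1 + C(1 - u, 1 - v)` is the survival copula and `F̄ᵢ = 1 - Fᵢ`. -/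
theorem quintuple_stmt18
    {Ω : Type*} [MeasurableSpace Ω] (ℙ : Measure Ω) [IsProbabilityMeasure ℙ]
    (ξ : Ω → ℝ × ℝ) (hξmeas : Measurable ξ)
    -- strictly positive components
    (hpos : ∀ᵐ ω ∂ℙ, 0 < (ξ ω).1 ∧ 0 < (ξ ω).2)
    -- marginal distribution functions
    (F₁ F₂ : ℝ → ℝ)
    (hF₁ : ∀ a : ℝ, F₁ a = (ℙ {ω | (ξ ω).1 ≤ a}).toReal)
    (hF₂ : ∀ b : ℝ, F₂ b = (ℙ {ω | (ξ ω).2 ≤ b}).toReal)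
    -- absolute continuity of the marginal laws
    (hac₁ : ℙ.map (fun ω => (ξ ω).1) ≪ (volume : Measure ℝ))
    (hac₂ : ℙ.map (fun ω => (ξ ω).2) ≪ (volume : Measure ℝ))
    -- a twice continuously differentiable copula
    (C : ℝ → ℝ → ℝ) (hC : ContDiff ℝ 2 (Function.uncurry C))
    (hCgrounded : ∀ u ∈ Icc (0:ℝ) 1, C u 0 = 0 ∧ C 0 u = 0)
    (hCmargins : ∀ u ∈ Icc (0:ℝ) 1, C u 1 = u ∧ C 1 u = u)
    -- Sklar's representation of the joint distribution function
    (hSklar : ∀ a b : ℝ,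
      (ℙ {ω | (ξ ω).1 ≤ a ∧ (ξ ω).2 ≤ b}).toReal = C (F₁ a) (F₂ b))
    -- the survival copula
    (Ct : ℝ → ℝ → ℝ) (hCt : ∀ u v : ℝ, Ct u v = u + v - 1 + C (1 - u) (1 - v)) :
    ∀ z > (0:ℝ),
      (ℙ {ω | z < (ξ ω).1 + (ξ ω).2}).toReal
        = ∫ x in Ioi (0:ℝ),
            deriv (fun u => Ct u (1 - F₂ ((z - x) ⊔ 0))) (1 - F₁ x)
            ∂(ℙ.map (fun ω => (ξ ω).1)) := by
  intro z hz
  have hX : Measurable (fun ω => (ξ ω).1) := measurable_fst.comp hξmeas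
  have hY : Measurable (fun ω => (ξ ω).2) := measurable_snd.comp hξmeas
  set μ := ℙ.map (fun ω => (ξ ω).1) with hμ
  set ν := ℙ.map (fun ω => (ξ ω).2) with hν
  have : IsProbabilityMeasure μ := Measure.isProbabilityMeasure_map hX.aemeasurable
  have : IsProbabilityMeasure ν := Measure.isProbabilityMeasure_map hY.aemeasurable
  have hF₁' : F₁ = fun a => μ.real (Iic a) := by
    funext a
    rw [hF₁, measureReal_def, hμ, Measure.map_apply hX measurableSet_Iic]; rfl
  have hF₂' : F₂ = fun a => ν.real (Iic a) := by
    funext a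
    rw [hF₂, measureReal_def, hν, Measure.map_apply hY measurableSet_Iic]; rfl
  have hc₁ : Continuous F₁ := hF₁' ▸ aux_cdf_cont μ hac₁
  have hc₂ : Continuous F₂ := hF₂' ▸ aux_cdf_cont ν hac₂
  have hI₁ : ∀ x, F₁ x ∈ Icc (0:ℝ) 1 := fun x => by
    rw [hF₁']; exact ⟨measureReal_nonneg, measureReal_le_one⟩
  have hI₂ : ∀ x, F₂ x ∈ Icc (0:ℝ) 1 := fun x => by
    rw [hF₂']; exact ⟨measureReal_nonneg, measureReal_le_one⟩
  have hμ0 : μ (Iic 0) = 0 := by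
    rw [hμ, Measure.map_apply hX measurableSet_Iic]
    refine measure_mono_null ?_ hpos
    intro ω hω h
    exact absurd h.1 (not_lt.2 hω)
  have hν0 : ∀ b ≤ (0:ℝ), F₂ b = 0 := by
    intro b hb
    rw [hF₂]
    have : ℙ {ω | (ξ ω).2 ≤ b} = 0 := by
      refine measure_mono_null ?_ hpos
      intro ω hω h
      exact absurd h.2 (not_lt.2 (le_trans hω hb))
    simp [this]
  have hmax : ∀ x, F₂ ((z - x) ⊔ 0) = F₂ (z - x) := by
    intro x
    rcases le_total (z - x) 0 with h | h
    · rw [sup_eq_right.2 h, hν0 _ h, hν0 _ le_rfl]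
    · rw [sup_eq_left.2 h]
  -- the partial derivative
  obtain ⟨G, hG⟩ : ∃ G : ℝ → ℝ → ℝ, G = fun u v => fderiv ℝ (Function.uncurry C) (u, v) (1, 0) :=
    ⟨_, rfl⟩
  have hGc : Continuous (fun p : ℝ × ℝ => G p.1 p.2) := by
    rw [hG]
    exact (hC.continuous_fderiv (by norm_num)).clm_apply continuous_const
  have hGd : ∀ u v, HasDerivAt (fun u => C u v) (G u v) u := by
    intro u v
    have h1 : HasFDerivAt (Function.uncurry C) (fderiv ℝ (Function.uncurry C) (u, v)) (u, v) :=
      (hC.differentiable (by norm_num) (u, v)).hasFDerivAt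
    have h2 : HasDerivAt (fun u : ℝ => (u, v)) ((1 : ℝ), (0 : ℝ)) u :=
      (hasDerivAt_id u).prodMk (hasDerivAt_const u v)
    rw [hG]
    exact h1.comp_hasDerivAt u h2
  obtain ⟨M, hM⟩ := ((isCompact_Icc (a := (0:ℝ)) (b := 1)).prod
    (isCompact_Icc (a := (0:ℝ)) (b := 1))).exists_bound_of_continuousOn hGc.continuousOn
  have hint : ∀ w : ℝ → ℝ, Continuous w → Integrable (fun x => G (F₁ x) (F₂ (w x))) μ := by
    intro w hw
    refine Integrable.of_bound (C := M) ?_ (ae_of_all _ fun x => hM (F₁ x, F₂ (w x)) ⟨hI₁ _, hI₂ _⟩)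
    exact (hGc.comp (hc₁.prodMk (hc₂.comp hw))).aestronglyMeasurable
  have hkey : ∀ a b, ∫ x in Iic a, G (F₁ x) (F₂ b) ∂μ = C (F₁ a) (F₂ b) := by
    intro a b
    have hg : Continuous (fun u => G u (F₂ b)) := hGc.comp (continuous_id.prodMk continuous_const)
    have h1 := integral_map (μ := μ.restrict (Iic a)) (φ := F₁) hc₁.aemeasurable
      (f := fun u => G u (F₂ b)) hg.aestronglyMeasurable
    rw [← h1]
    have h2 : (μ.restrict (Iic a)).map F₁ = volume.restrict (Ioc 0 (F₁ a)) := by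
      rw [hF₁']; exact aux_map μ hac₁ hμ0 a
    rw [h2, ← intervalIntegral.integral_of_le (hI₁ a).1,
      intervalIntegral.integral_eq_sub_of_hasDerivAt (fun u _ => hGd u (F₂ b))
        (hg.intervalIntegrable _ _), (hCgrounded _ (hI₂ b)).2, sub_zero]
  -- disintegration
  set ρ := ℙ.map ξ with hρ
  have : IsProbabilityMeasure ρ := Measure.isProbabilityMeasure_map hξmeas.aemeasurable
  have hfst : ρ.fst = μ := by
    rw [Measure.fst, hρ, Measure.map_map measurable_fst hξmeas]; rfl
  have hρa : ∀ s, MeasurableSet s → ρ s = ℙ (ξ ⁻¹' s) := fun s hs =>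
    Measure.map_apply hξmeas hs
  have hκm : ∀ b, Measurable (fun x => (ρ.condKernel x).real (Iic b)) := fun b =>
    (ProbabilityTheory.Kernel.measurable_coe _ measurableSet_Iic).ennreal_toReal
  have hκi : ∀ b, Integrable (fun x => (ρ.condKernel x).real (Iic b)) μ := fun b =>
    Integrable.of_bound (C := 1) (hκm b).aestronglyMeasurable (ae_of_all _ fun x => by
      rw [Real.norm_of_nonneg measureReal_nonneg]; exact measureReal_le_one)
  have hae : ∀ b, (fun x => (ρ.condKernel x).real (Iic b)) =ᵐ[μ] fun x => G (F₁ x) (F₂ b) := by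
    intro b
    refine aux_ae μ _ _ (hκi b) (hint (fun _ => b) continuous_const) fun a => ?_
    rw [hkey a b, ← hSklar]
    have h1 := Measure.setLIntegral_condKernel_eq_measure_prod (ρ := ρ)
      (measurableSet_Iic (a := a)) (measurableSet_Iic (a := b))
    rw [hfst, hρa _ (measurableSet_Iic.prod measurableSet_Iic)] at h1
    simp only [measureReal_def]
    rw [integral_toReal (ProbabilityTheory.Kernel.measurable_coe _ measurableSet_Iic).aemeasurable
      (ae_of_all _ fun x => measure_lt_top _ _), h1]
    rfl
  have hall : ∀ᵐ x ∂μ, ∀ b, (ρ.condKernel x).real (Iic b) = G (F₁ x) (F₂ b) := by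
    have hq : ∀ᵐ x ∂μ, ∀ q : ℚ, (ρ.condKernel x).real (Iic (q:ℝ)) = G (F₁ x) (F₂ q) :=
      ae_all_iff.2 fun q => hae q
    filter_upwards [hq] with x hx b
    obtain ⟨u, -, hu1, hu2⟩ := Real.exists_seq_rat_strictAnti_tendsto b
    have hcx : Continuous (fun b => G (F₁ x) (F₂ b)) :=
      hGc.comp (continuous_const.prodMk hc₂)
    have t1 : Tendsto (fun n => G (F₁ x) (F₂ (u n))) atTop (nhds (G (F₁ x) (F₂ b))) :=
      (hcx.tendsto b).comp hu2
    have t2 : Tendsto (fun n => (ρ.condKernel x).real (Iic (u n : ℝ))) atTop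
        (nhds ((ρ.condKernel x).real (Iic b))) := by
      simp only [← ProbabilityTheory.cdf_eq_real]
      refine Tendsto.comp ((ProbabilityTheory.cdf (ρ.condKernel x)).right_continuous b)
        (tendsto_nhdsWithin_iff.2 ⟨hu2, Eventually.of_forall fun n => (hu1 n).le⟩)
    simp only [hx] at t2
    exact tendsto_nhds_unique t2 t1
  have hle : ℙ.real {ω | (ξ ω).1 + (ξ ω).2 ≤ z} = ∫ x, G (F₁ x) (F₂ (z - x)) ∂μ := by
    have hs : MeasurableSet {p : ℝ × ℝ | p.1 + p.2 ≤ z} :=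
      measurableSet_le (measurable_fst.add measurable_snd) measurable_const
    have h1 := Measure.lintegral_condKernel_mem (ρ := ρ) hs
    rw [hfst, hρa _ hs] at h1
    have h2 : ∀ x, {y : ℝ | (x, y) ∈ {p : ℝ × ℝ | p.1 + p.2 ≤ z}} = Iic (z - x) := by
      intro x; ext y; simp only [mem_setOf_eq, mem_Iic]; constructor <;> intro h <;> linarith
    have hm : Measurable (fun x => ρ.condKernel x (Iic (z - x))) := by
      have := ProbabilityTheory.Kernel.measurable_kernel_prodMk_left (κ := ρ.condKernel) hs
      convert this using 3 with x
      exact (h2 x).symm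
    simp only [h2] at h1
    rw [measureReal_def, show {ω | (ξ ω).1 + (ξ ω).2 ≤ z} = ξ ⁻¹' {p : ℝ × ℝ | p.1 + p.2 ≤ z} from rfl,
      ← h1, ← integral_toReal hm.aemeasurable (ae_of_all _ fun x => measure_lt_top _ _)]
    refine integral_congr_ae ?_
    filter_upwards [hall] with x hx
    exact hx _
  have hderiv : ∀ x, deriv (fun u => Ct u (1 - F₂ ((z - x) ⊔ 0))) (1 - F₁ x)
      = 1 - G (F₁ x) (F₂ (z - x)) := by
    intro x
    rw [hmax]
    apply HasDerivAt.deriv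
    simp only [hCt, sub_sub_cancel]
    have h1 : HasDerivAt (fun u : ℝ => 1 - u) (-1) (1 - F₁ x) := by
      simpa using (hasDerivAt_id (1 - F₁ x)).const_sub 1
    have h2 : HasDerivAt (fun u => C u (F₂ (z - x))) (G (F₁ x) (F₂ (z - x))) (1 - (1 - F₁ x)) := by
      rw [sub_sub_cancel]; exact hGd _ _
    have h3 := ((((hasDerivAt_id (1 - F₁ x)).add_const (1 - F₂ (z - x))).sub_const 1).add
      (h2.comp (1 - F₁ x) h1))
    have h4 : 1 - G (F₁ x) (F₂ (z - x)) = 1 + G (F₁ x) (F₂ (z - x)) * -1 := by ring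
    rw [h4]
    exact h3
  simp only [hderiv]
  have hres : μ.restrict (Ioi 0) = μ := by
    apply Measure.restrict_eq_self_of_ae_mem
    rw [ae_iff]
    convert hμ0 using 2
    ext x; simp
  rw [hres, integral_sub (integrable_const _) (hint (fun x => z - x) (by fun_prop)), ← hle]
  have hms : MeasurableSet {ω | (ξ ω).1 + (ξ ω).2 ≤ z} :=
    measurableSet_le (hX.add hY) measurable_const
  have hcompl : {ω | z < (ξ ω).1 + (ξ ω).2} = {ω | (ξ ω).1 + (ξ ω).2 ≤ z}ᶜ := by
    ext ω; simp
  rw [hcompl, ← measureReal_def, probReal_compl_eq_one_sub hms]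
  simp
end
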